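/- arXiv:2508.10079 — 4 statements merged into one kernel-verified Lean document; each statement's English description precedes it below -/
import Mathlib

section
/- Let F be a field of odd characteristic p, and let A be an n×n nonderogatory matrix over F whose trace is an integer multiple of the identity (i.e., Tr(A) = t·1_F for some t ∈ {0,1,…,p−1}). Then there exist matrices E and V with A = E + V, E^p = E, and V^3 = 0. -/
open Polynomial in
lemma exists_hess_basis {F M : Type*} [Field F] [AddCommGroup M] [Module F M]
    [FiniteDimensional F M] (φ : Module.End F M) (n : ℕ) (hn : Module.finrank F M = n)
    (hm : (minpoly F φ).natDegree = n) (d : ℕ → F) :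
    ∃ b : Module.Basis (Fin n) F M, ∀ (i : ℕ) (h : i + 1 < n),
      φ (b ⟨i, by omega⟩) = b ⟨i + 1, h⟩ + d i • b ⟨i, by omega⟩ := by
  obtain ⟨x, hx⟩ := Module.exists_ker_toSpanSingleton_eq_annihilator F[X] (Module.AEval' φ)
  rw [← span_minpoly_eq_annihilator] at hx
  let v : M := (Module.AEval'.of φ).symm x
  have hv : ∀ q : F[X], aeval φ q v = 0 → minpoly F φ ∣ q := by
    intro q hq
    rw [← Ideal.mem_span_singleton, ← hx, LinearMap.mem_ker, LinearMap.toSpanSingleton_apply]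
    have := Module.AEval.of_aeval_smul (R := F) (M := M) φ q v
    have h2 : (Module.AEval.of F M φ) v = x := by simp [v, Module.AEval'.of]
    rw [h2] at this
    rw [← this]
    have h3 : aeval φ q • v = 0 := hq
    rw [h3, map_zero]
  let q : ℕ → F[X] := fun i => ∏ j ∈ Finset.range i, (X - C (d j))
  have hdeg : ∀ i, (q i).degree = i := by
    intro i
    simp [q, degree_prod]
  let S : Polynomial.Sequence F := ⟨q, hdeg⟩
  let f : F[X] →ₗ[F] M := (LinearMap.applyₗ v).comp (aeval φ).toLinearMap
  have hf : ∀ r, f r = aeval φ r v := fun r => rfl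
  have hli : LinearIndependent F (fun i : Fin n => q i) :=
    S.linearIndependent.comp (fun i : Fin n => (i : ℕ)) Fin.val_injective
  have hspan : Submodule.span F (Set.range (fun i : Fin n => q i)) ≤ degreeLT F n := by
    rw [Submodule.span_le]
    rintro _ ⟨i, rfl⟩
    simp only [SetLike.mem_coe, mem_degreeLT, hdeg]
    exact_mod_cast i.2
  have hli2 : LinearIndependent F (f ∘ (fun i : Fin n => q i)) := by
    apply hli.map
    rw [Submodule.disjoint_def]
    intro r hr hr2
    by_contra h0
    have h1 := mem_degreeLT.1 (hspan hr)
    have h2 := degree_le_of_dvd (hv r hr2) h0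
    rw [degree_eq_natDegree (minpoly.ne_zero (Algebra.IsIntegral.isIntegral φ)), hm] at h2
    exact absurd h1 (not_lt.2 h2)
  rcases Nat.eq_zero_or_pos n with h0 | h0
  · subst h0
    exact ⟨Module.finBasisOfFinrankEq F M hn, fun i h => absurd h (by omega)⟩
  have : Nonempty (Fin n) := ⟨⟨0, h0⟩⟩
  refine ⟨basisOfLinearIndependentOfCardEqFinrank hli2 (by simp [hn]), fun i h => ?_⟩
  simp only [coe_basisOfLinearIndependentOfCardEqFinrank, Function.comp, hf]
  have : q (i+1) = (X - C (d i)) * q i := by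
    simp only [q, Finset.prod_range_succ]; ring
  rw [this]
  simp [sub_mul]

lemma core {F M : Type*} [Field F] [AddCommGroup M] [Module F M]
    (p N : ℕ) (φ : Module.End F M) (b : Module.Basis (Fin (N+1)) F M) (d : ℕ → F)
    (S : Set ℕ)
    (hb : ∀ (i : ℕ) (h : i + 1 < N + 1),
      φ (b ⟨i, by omega⟩) = b ⟨i + 1, h⟩ + d i • b ⟨i, by omega⟩)
    (htr : LinearMap.trace F M φ = ∑ i ∈ Finset.range (N+1), d i)
    (hd : ∀ i, d i ^ p = d i)
    (hS3 : ∀ i, i + 2 < N → i ∈ S → i + 1 ∈ S → i + 2 ∉ S)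
    (hS2 : ∀ i, i < N → i ∉ S → i + 1 < N ∧ i + 1 ∈ S ∧ d i ≠ d (i+1))
    (hN : ∀ i, i < N → d i ≠ d N) :
    ∃ E V : Module.End F M, φ = E + V ∧ E ^ p = E ∧ V ^ 3 = 0 := by
  classical
  let e : ℕ → M := fun i => if h : i < N + 1 then b ⟨i, h⟩ else 0
  have he : ∀ i (h : i < N + 1), b ⟨i, h⟩ = e i := fun i h => by simp only [e]; rw [dif_pos h]
  let V : Module.End F M := b.constr F
    (fun i => if (i : ℕ) < N ∧ (i : ℕ) ∈ S then e (i + 1) else 0)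
  have hV : ∀ i, i < N + 1 → V (e i) = if i < N ∧ i ∈ S then e (i + 1) else 0 := by
    intro i h
    rw [← he i h]
    simp only [V]; rw [Module.Basis.constr_basis]
  have hφ : ∀ i, i < N → φ (e i) = e (i+1) + d i • e i := by
    intro i h
    have := hb i (by omega)
    rwa [he, he] at this
  set E : Module.End F M := φ - V with hE
  have hE1 : ∀ i, i < N → i ∈ S → E (e i) = d i • e i := by
    intro i h hi
    simp [hE, hφ i h, hV i (by omega), h, hi]
  have hE2 : ∀ i, i < N → i ∉ S → E (e i) = e (i+1) + d i • e i := by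
    intro i h hi
    simp [hE, hφ i h, hV i (by omega), hi]
  let W : Submodule F M := Submodule.span F {x | ∃ i, i < N ∧ x = e i}
  have hEN : E (e N) - d N • e N ∈ W := by
    have h1 : E (e N) = φ (e N) := by simp [hE, hV N (by omega)]
    rw [h1]
    have h2 := LinearMap.trace_eq_matrix_trace F b φ
    rw [htr, Matrix.trace, Fin.sum_univ_castSucc, Finset.sum_range_succ, Finset.sum_range] at h2
    have h3 : ∀ i : Fin N, (LinearMap.toMatrix b b φ).diag i.castSucc = d i := by
      intro i
      have := hb i (by omega)
      rw [Matrix.diag_apply, LinearMap.toMatrix_apply]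
      have h4 : b i.castSucc = b ⟨i, by omega⟩ := rfl
      rw [h4, this, map_add, map_smul, Module.Basis.repr_self, Module.Basis.repr_self]
      simp [Finsupp.single_apply, Fin.ext_iff]
    simp only [h3] at h2
    have h5 := add_left_cancel h2
    rw [Matrix.diag_apply, LinearMap.toMatrix_apply] at h5
    have h6 : b (Fin.last N) = e N := he N (by omega)
    rw [h6] at h5
    have h7 := b.sum_repr (φ (e N))
    rw [Fin.sum_univ_castSucc, h6, ← h5] at h7
    rw [← h7, add_sub_cancel_right]
    refine Submodule.sum_mem _ fun i _ => Submodule.smul_mem _ _ (Submodule.subset_span ?_)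
    exact ⟨i, i.2, he i (by omega)⟩
  let K : Submodule F M := LinearMap.ker (E ^ p - E)
  have hK : ∀ (x : M) (i : ℕ), E x = d i • x → x ∈ K := by
    intro x i hx
    have : ∀ k : ℕ, (E ^ k) x = d i ^ k • x := by
      intro k
      induction k with
      | zero => simp
      | succ k ih => rw [pow_succ, Module.End.mul_apply, hx, map_smul, ih, smul_smul, pow_succ']
    simp [K, this, hx, hd]
  have hKe : ∀ i, i < N → e i ∈ K := by
    intro i h
    by_cases hi : i ∈ S
    · exact hK _ i (hE1 i h hi)
    · obtain ⟨h1, h2, h3⟩ := hS2 i h hi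
      have h4 : e (i+1) ∈ K := hK _ (i+1) (hE1 _ h1 h2)
      have h5 : e i + (d i - d (i+1))⁻¹ • e (i+1) ∈ K := by
        apply hK _ i
        have h6 : d i - d (i+1) ≠ 0 := sub_ne_zero.2 h3
        rw [map_add, map_smul, hE2 i h hi, hE1 _ h1 h2]
        have : (1 : F) + (d i - d (i+1))⁻¹ * d (i+1) = d i * (d i - d (i+1))⁻¹ := by
          field_simp; ring
        rw [smul_add, smul_smul, smul_smul, ← this, add_smul, one_smul]
        abel
      exact (Submodule.add_mem_iff_left _ (Submodule.smul_mem _ _ h4)).1 h5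
  let L : Submodule F M := K.map (E - d N • (1 : Module.End F M))
  have hL : ∀ x ∈ K, E x - d N • x ∈ L := fun x hx => ⟨x, hx, by simp⟩
  have hLS : ∀ i, i < N → i ∈ S → e i ∈ L := by
    intro i h hi
    have h1 := hL _ (hKe i h)
    rw [hE1 i h hi, ← sub_smul] at h1
    exact (Submodule.smul_mem_iff _ (sub_ne_zero.2 (hN i h))).1 h1
  have hLe : ∀ i, i < N → e i ∈ L := by
    intro i h
    by_cases hi : i ∈ S
    · exact hLS i h hi
    · obtain ⟨h1, h2, h3⟩ := hS2 i h hi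
      have h4 := hL _ (hKe i h)
      rw [hE2 i h hi, add_sub_assoc, ← sub_smul] at h4
      have h5 := (Submodule.add_mem_iff_right _ (hLS _ h1 h2)).1 h4
      exact (Submodule.smul_mem_iff _ (sub_ne_zero.2 (hN i h))).1 h5
  have hWL : W ≤ L := by
    rw [Submodule.span_le]
    rintro _ ⟨i, h, rfl⟩
    exact hLe i h
  have hKN : e N ∈ K := by
    obtain ⟨u, hu, hu2⟩ := hWL hEN
    have : e N - u ∈ K := by
      apply hK _ N
      simp only [LinearMap.sub_apply, LinearMap.smul_apply, Module.End.one_apply] at hu2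
      rw [map_sub, smul_sub]
      rw [sub_eq_sub_iff_add_eq_add] at hu2 ⊢
      rw [← hu2, add_comm]
    have h2 := K.add_mem this hu
    rwa [sub_add_cancel] at h2
  refine ⟨E, V, by simp [hE], ?_, ?_⟩
  · apply b.ext
    intro i
    rw [← sub_eq_zero, ← LinearMap.sub_apply]
    change b i ∈ K
    obtain ⟨i, h⟩ := i
    rw [he i h]
    rcases Nat.lt_succ_iff_lt_or_eq.1 h with h | rfl
    · exact hKe i h
    · exact hKN
  · apply b.ext
    rintro ⟨i, h⟩
    rw [he i h, pow_succ, pow_two, Module.End.mul_apply, Module.End.mul_apply, hV i h]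
    split_ifs with h1
    · rw [hV _ (by omega)]
      split_ifs with h2
      · rw [hV _ (by omega), if_neg]
        · simp
        · rintro ⟨h3, h4⟩
          exact hS3 i h3 h1.2 h2.2 h4
      · simp
    · simp

lemma comb {p : ℕ} [Fact p.Prime] (hp : Odd p) (N : ℕ) (t : ZMod p) :
    ∃ (d : ℕ → ZMod p) (S : Set ℕ), ∑ i ∈ Finset.range (N+1), d i = t ∧
    (∀ i, i + 2 < N → i ∈ S → i + 1 ∈ S → i + 2 ∉ S) ∧
    (∀ i, i < N → i ∉ S → i + 1 < N ∧ i + 1 ∈ S ∧ d i ≠ d (i+1)) ∧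
    (∀ i, i < N → d i ≠ d N) := by
  have two : (2 : ZMod p) ≠ 0 := by
    intro h
    have h1 : ((2 : ℕ) : ZMod p) = 0 := by exact_mod_cast h
    rw [ZMod.natCast_eq_zero_iff] at h1
    have h2 := (Nat.prime_dvd_prime_iff_eq Fact.out Nat.prime_two).1 h1
    subst h2
    exact absurd hp (by decide)
  have neg1 : (-1 : ZMod p) ≠ 1 := by
    intro h; apply two; linear_combination -h
  have four : (4 : ZMod p) ≠ 0 := by
    have : (4 : ZMod p) = 2 * 2 := by norm_num
    rw [this]; exact mul_ne_zero two two
  -- the generic case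
  have gen : ∀ S : Set ℕ, 2 ≤ N → 0 ∈ S → 1 ∈ S →
      (∀ i, i + 2 < N → i ∈ S → i + 1 ∈ S → i + 2 ∉ S) →
      (∀ i, i < N → i ∉ S → i + 1 < N ∧ i + 1 ∈ S) →
      ∃ (d : ℕ → ZMod p) (S : Set ℕ), ∑ i ∈ Finset.range (N+1), d i = t ∧
      (∀ i, i + 2 < N → i ∈ S → i + 1 ∈ S → i + 2 ∉ S) ∧
      (∀ i, i < N → i ∉ S → i + 1 < N ∧ i + 1 ∈ S ∧ d i ≠ d (i+1)) ∧
      (∀ i, i < N → d i ≠ d N) := by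
    intro S h2 h0 h1 hS3 hS2
    obtain ⟨m, rfl⟩ : ∃ m, N = m + 2 := ⟨N - 2, by omega⟩
    obtain ⟨a, c, ha, hc, hac⟩ : ∃ a c : ZMod p, a ≠ 0 ∧ c ≠ 0 ∧
        a + c = t - ∑ i ∈ Finset.range m, (-1) ^ i := by
      generalize t - ∑ i ∈ Finset.range m, (-1 : ZMod p) ^ i = s
      by_cases hs : s = 1
      · exact ⟨-1, 2, by simp, two, by rw [hs]; norm_num⟩
      · exact ⟨1, s - 1, by simp, sub_ne_zero.2 hs, by ring⟩
    let d : ℕ → ZMod p := fun i => if i = 0 then a else if i = 1 then c else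
      if i = m + 2 then 0 else (-1) ^ i
    refine ⟨d, S, ?_, hS3, ?_, ?_⟩
    · rw [Finset.sum_range_succ, Finset.sum_range_succ', Finset.sum_range_succ']
      have : ∑ i ∈ Finset.range m, d (i + 1 + 1) = ∑ i ∈ Finset.range m, (-1) ^ i := by
        apply Finset.sum_congr rfl
        intro i hi
        have := Finset.mem_range.1 hi
        simp [d, this.ne, pow_succ]
      rw [this]
      simp only [d, if_true, zero_add, one_ne_zero, if_false, Nat.add_eq_zero_iff, and_false,
        OfNat.ofNat_ne_zero, show m + 2 ≠ 1 by omega]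
      linear_combination hac
    · intro i hi his
      obtain ⟨h3, h4⟩ := hS2 i hi his
      refine ⟨h3, h4, ?_⟩
      have hi0 : i ≠ 0 := by rintro rfl; exact his h0
      have hi1 : i ≠ 1 := by rintro rfl; exact his h1
      have e1 : d i = (-1) ^ i := by simp [d, hi0, hi1, hi.ne]
      have e2 : d (i+1) = (-1) ^ (i+1) := by
        simp only [d]
        rw [if_neg (by omega), if_neg (by omega), if_neg (by omega)]
      rw [e1, e2, pow_succ]
      intro h
      have h5 : (-1 : ZMod p) ^ i ≠ 0 := by simp
      apply neg1
      apply mul_left_cancel₀ h5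
      rw [← h, mul_one]
    · intro i hi
      have : d (m+2) = 0 := by simp [d]
      rw [this]
      simp only [d]
      split_ifs
      · exact ha
      · exact hc
      · omega
      · simp
  obtain ⟨z, hz⟩ : ∃ z : ZMod p, 4 * z ≠ t := by
    by_cases h : t = 0
    · exact ⟨1, by simpa [h] using four⟩
    · exact ⟨0, by simpa using Ne.symm h⟩
  rcases Nat.even_or_odd N with hN | hN
  · rcases Nat.eq_zero_or_pos N with rfl | h0
    · exact ⟨fun _ => t, ∅, by simp⟩
    · obtain ⟨k, hk⟩ := hN
      apply gen {i | i = 0 ∨ i % 2 = 1} (by omega) (by simp) (by simp)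
      · intro i; simp only [Set.mem_ofPred_eq]; omega
      · intro i; simp only [Set.mem_ofPred_eq]; omega
  · obtain ⟨k, hk⟩ := hN
    by_cases h1 : N = 1
    · subst h1
      refine ⟨fun i => if i = 0 then t - 2 * z else 2 * z, {0}, ?_, ?_, ?_, ?_⟩
      · simp [Finset.sum_range_succ]
      · intro i; omega
      · intro i hi h; simp at h; omega
      · intro i hi
        have : i = 0 := by omega
        subst this
        simp only [if_true, one_ne_zero, if_false]
        intro h; apply hz; linear_combination -h
    by_cases h3 : N = 3
    · subst h3
      refine ⟨fun i => if i = 0 then t - 3 * z else if i = 1 then z + 1 else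
        if i = 2 then z - 1 else z, {0, 2}, ?_, ?_, ?_, ?_⟩
      · simp [Finset.sum_range_succ]; ring
      · intro i; simp; omega
      · intro i hi h
        have : i = 1 := by simp at h; omega
        subst this
        simp
        intro h; apply two; linear_combination h
      · intro i hi
        interval_cases i
        · simp; intro h; apply hz; linear_combination -h
        · simp
        · simp
    · apply gen {i | i = 0 ∨ i = 1 ∨ i = 3 ∨ (4 ≤ i ∧ i % 2 = 0)} (by omega) (by simp) (by simp)
      · intro i; simp only [Set.mem_ofPred_eq]; omega
      · intro i; simp only [Set.mem_ofPred_eq]; omega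

theorem stmt_1 {F : Type*} [Field F] (p : ℕ) [Fact p.Prime] (hp : Odd p)
    [CharP F p] (n : ℕ) (hn : 0 < n) (A : Matrix (Fin n) (Fin n) F)
    (hA : A.charpoly = minpoly F A)
    (t : ℕ) (ht : t < p) (htr : A.trace = (t : F)) :
    ∃ E V : Matrix (Fin n) (Fin n) F, A = E + V ∧ E ^ p = E ∧ V ^ 3 = 0 := by
  obtain ⟨N, rfl⟩ : ∃ N, n = N + 1 := ⟨n - 1, by omega⟩
  obtain ⟨d, S, hsum, hS3, hS2, hN⟩ := comb hp N (t : ZMod p)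
  let c : ZMod p →+* F := ZMod.castHom dvd_rfl F
  have hc : Function.Injective c := c.injective
  let φ : Module.End F (Fin (N+1) → F) := Matrix.toLinAlgEquiv' A
  have hm : (minpoly F φ).natDegree = N + 1 := by
    have : minpoly F φ = minpoly F A := minpoly.algEquiv_eq _ A
    rw [this, ← hA, Matrix.charpoly_natDegree_eq_dim, Fintype.card_fin]
  obtain ⟨b, hb⟩ := exists_hess_basis φ (N+1) (by simp) hm (fun i => c (d i))
  have htr' : LinearMap.trace F _ φ = ∑ i ∈ Finset.range (N+1), c (d i) := by
    rw [← map_sum, hsum, map_natCast, ← htr]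
    exact Matrix.trace_toLin'_eq A
  obtain ⟨E, V, h1, h2, h3⟩ := core p N φ b (fun i => c (d i)) S hb htr'
    (fun i => by rw [← map_pow, ZMod.pow_card]) hS3
    (fun i hi his => ⟨(hS2 i hi his).1, (hS2 i hi his).2.1,
      fun h => (hS2 i hi his).2.2 (hc h)⟩)
    (fun i hi h => hN i hi (hc h))
  let ψ : Module.End F (Fin (N+1) → F) ≃ₐ[F] Matrix (Fin (N+1)) (Fin (N+1)) F :=
    Matrix.toLinAlgEquiv'.symm
  refine ⟨ψ E, ψ V, ?_, ?_, ?_⟩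
  · rw [← map_add, ← h1]
    exact (AlgEquiv.symm_apply_apply _ A).symm
  · rw [← map_pow, h2]
  · rw [← map_pow, h3, map_zero]
end

section
/- Let F be a field of odd characteristic p, n ≥ 3, a ∈ {1,…,p−1}, and k ∈ {1,…,n−1} with n−k odd. Let C ∈ M_n(F) be a companion matrix with Tr(C) = ((n+k+1)/2 · a − l)·1_F for some l ∈ {1,…,p−1}. Then C is similar to a matrix D that admits a decomposition D = E + V with E^p = E, V^{k+1} = 0, the first column of V zero, and the last row of E equal to (0,…,0,a). -/
/-- The companion matrix of the polynomial `X^n + c_{n-1} X^{n-1} + ⋯ + c_0`. -/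
def companionMatrix {F : Type*} [Field F] {n : ℕ} (c : Fin n → F) :
    Matrix (Fin n) (Fin n) F :=
  Matrix.of fun i j =>
    if (j : ℕ) = n - 1 then -c i else if (i : ℕ) = (j : ℕ) + 1 then 1 else 0

/-- Similarity of square matrices. -/
def MatSimilar {F : Type*} [Field F] {n : ℕ} (A B : Matrix (Fin n) (Fin n) F) : Prop :=
  ∃ P : (Matrix (Fin n) (Fin n) F)ˣ,
    A = (P : Matrix (Fin n) (Fin n) F) * B * ((↑(P⁻¹) : Matrix (Fin n) (Fin n) F))

open Polynomial in
lemma aux_polys {F : Type*} [Field F] (d : ℕ → F) : ∀ (n : ℕ) (χ : F[X]), χ.Monic →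
    χ.natDegree = n → ∃ (g : ℕ → F[X]) (w : ℕ → F), g 0 = 1 ∧ g n = χ ∧
      (∀ j ≤ n, (g j).Monic ∧ (g j).natDegree = j) ∧
      (∀ j < n, g (j + 1) = (X - C (d j)) * g j - C (w j)) := by
  intro n
  induction n with
  | zero =>
    intro χ hm hd
    refine ⟨fun _ => 1, fun _ => 0, rfl, ?_, ?_, ?_⟩
    · exact (hm.natDegree_eq_zero.mp hd).symm
    · intro j hj
      obtain rfl : j = 0 := by omega
      simp
    · intro j hj; omega
  | succ n ih =>
    intro χ hm hd
    have hq : (χ /ₘ (X - C (d n))).natDegree = n := by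
      rw [natDegree_divByMonic _ (monic_X_sub_C _), hd, natDegree_X_sub_C]; rfl
    have hmod := modByMonic_add_div χ (X - C (d n))
    rw [modByMonic_X_sub_C_eq_C_eval] at hmod
    have hmon : (χ /ₘ (X - C (d n))).Monic := by
      have hdeg : (X - C (d n)).degree ≤ χ.degree := by
        rw [degree_X_sub_C, degree_eq_natDegree hm.ne_zero, hd]
        exact_mod_cast Nat.succ_le_succ (Nat.zero_le n)
      have := leadingCoeff_divByMonic_of_monic (monic_X_sub_C (d n)) hdeg
      rw [Monic, this]; exact hm
    obtain ⟨g, w, h0, hn, h1, h2⟩ := ih _ hmon hq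
    refine ⟨fun j => if j ≤ n then g j else χ, fun j => if j < n then w j else - χ.eval (d n),
      ?_, ?_, ?_, ?_⟩
    · simp [h0]
    · simp
    · intro j hj
      by_cases h : j ≤ n
      · simpa [h] using h1 j h
      · obtain rfl : j = n + 1 := by omega
        simp [hm, hd]
    · intro j hj
      by_cases h : j < n
      · simp [h, h.le, Nat.succ_le_of_lt h, h2 j h]
      · obtain rfl : j = n := by omega
        simp [hn]
        linear_combination - hmod

/-- Hessenberg form. -/
def hess {F : Type*} [Field F] (n : ℕ) (d w : ℕ → F) : Matrix (Fin n) (Fin n) F :=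
  Matrix.of fun i j => (if (i : ℕ) = j then d j else 0) + (if (i : ℕ) = j + 1 then 1 else 0)
    + (if (i : ℕ) = 0 then w j else 0)

open Polynomial in
lemma aux_similar {F : Type*} [Field F] {n : ℕ} (hn : 3 ≤ n) (c : Fin n → F) (d : ℕ → F)
    (htr : (companionMatrix c).trace = ∑ j ∈ Finset.range n, d j) :
    ∃ (w : ℕ → F) (P : Matrix (Fin n) (Fin n) F), w 0 = 0 ∧ IsUnit P.det ∧
      companionMatrix c * P = P * hess n d w := by
  set χ : F[X] := X ^ n + ∑ i : Fin n, C (c i) * X ^ (i : ℕ) with hχ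
  have hdeg : (∑ i : Fin n, C (c i) * X ^ (i : ℕ)).degree < (n : WithBot ℕ) :=
    degree_sum_fin_lt c
  have hmon : χ.Monic := monic_X_pow_add hdeg
  have hnat : χ.natDegree = n := by
    have : χ.degree = n := by
      rw [hχ, degree_add_eq_left_of_degree_lt] <;> simp [hdeg]
    exact natDegree_eq_of_degree_eq_some this
  have hcoef : ∀ i : Fin n, χ.coeff i = c i := by
    intro i
    have hi := i.2.ne
    simp only [hχ, coeff_add, coeff_X_pow, finsetSum_coeff, coeff_C_mul, Fin.val_inj]
    simp [hi]
  obtain ⟨g, w, g0, gn, gm, gr⟩ := aux_polys d n χ hmon hnat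
  set P : Matrix (Fin n) (Fin n) F := Matrix.of fun i j => (g j).coeff i with hP
  have hdet : P.det = 1 := by
    rw [Matrix.det_of_isUpperTriangular]
    · apply Finset.prod_eq_one
      intro j _
      have := gm j j.2.le
      have h1 := this.1.coeff_natDegree
      rw [this.2] at h1
      simpa [hP] using h1
    · intro i j hij
      have := gm j j.2.le
      simp only [hP, Matrix.of_apply]
      apply coeff_eq_zero_of_natDegree_lt
      rw [this.2]; exact hij
  have hCP : companionMatrix c * P = P * hess n d w := by
    ext i j
    have hR : (P * hess n d w) i j = P i j * d j
        + (if h : (j : ℕ) + 1 < n then P i ⟨j + 1, h⟩ else 0) + P i ⟨0, by omega⟩ * w j := by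
      simp only [Matrix.mul_apply, hess, Matrix.of_apply, mul_add, Finset.sum_add_distrib]
      congr 1
      · congr 1
        · rw [Finset.sum_eq_single j]
          · simp
          · intro b _ hb
            have : (b : ℕ) ≠ j := fun h => hb (Fin.ext h)
            simp [this]
          · simp
        · split_ifs with h
          · rw [Finset.sum_eq_single ⟨j + 1, h⟩]
            · simp
            · intro b _ hb
              have : (b : ℕ) ≠ j + 1 := fun h => hb (Fin.ext h)
              simp [this]
            · simp
          · apply Finset.sum_eq_zero
            intro b _
            have : (b : ℕ) ≠ j + 1 := by have := b.2; omega
            simp [this]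
      · rw [Finset.sum_eq_single ⟨0, by omega⟩]
        · simp
        · intro b _ hb
          have : (b : ℕ) ≠ 0 := fun h => hb (Fin.ext h)
          simp [this]
        · simp
    have hL : (companionMatrix c * P) i j = (X * g j).coeff i
        - c i * (g j).coeff (n - 1) := by
      simp only [Matrix.mul_apply, companionMatrix, Matrix.of_apply, hP]
      rw [← Finset.sum_erase_add _ _ (Finset.mem_univ (⟨n - 1, by omega⟩ : Fin n))]
      simp only [if_true]
      rw [sub_eq_add_neg, neg_mul]
      congr 1
      obtain ⟨i, hi⟩ := i
      rcases i with _ | i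
      · simp only [coeff_X_mul_zero]
        apply Finset.sum_eq_zero
        intro b hb
        have : (b : ℕ) ≠ n - 1 := fun h => (Finset.mem_erase.mp hb).1 (Fin.ext h)
        simp [this]
      · simp only [coeff_X_mul]
        rw [Finset.sum_eq_single ⟨i, by omega⟩]
        · have : i ≠ n - 1 := by omega
          simp [this]
        · intro b hb hb'
          have : (b : ℕ) ≠ n - 1 := fun h => (Finset.mem_erase.mp hb).1 (Fin.ext h)
          have h2 : i ≠ b := fun h => hb' (Fin.ext h.symm)
          simp [this, h2]
        · intro h
          exfalso; apply h
          simp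
          omega
    rw [hR, hL]
    have hj := gr j j.2
    have hc := congrArg (fun q : F[X] => q.coeff i) hj
    simp only [sub_mul, coeff_sub, coeff_C_mul] at hc
    have h1 := (gm j j.2.le)
    have hP0 : P i ⟨0, by omega⟩ * w j = (C (w j)).coeff i := by
      simp [hP, g0, coeff_one, coeff_C]
    rw [hP0]
    by_cases h : (j : ℕ) + 1 < n
    · have : (g j).coeff (n - 1) = 0 := by
        apply coeff_eq_zero_of_natDegree_lt
        rw [h1.2]; omega
      simp only [h, dif_pos, this, hP, Matrix.of_apply]
      rw [hc]; ring
    · have hjn : (j : ℕ) = n - 1 := by omega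
      have : (g j).coeff (n - 1) = 1 := by
        have := h1.1.coeff_natDegree
        rw [h1.2, hjn] at this
        rw [hjn]; exact this
      rw [show (j : ℕ) + 1 = n by omega, gn, hcoef] at hc
      simp only [h, dif_neg, this, hP, Matrix.of_apply, not_false_eq_true]
      rw [hc]; ring
  refine ⟨w, P, ?_, by simp [hdet], hCP⟩
  have hu : IsUnit P.det := by simp [hdet]
  have ht : (companionMatrix c).trace = (hess n d w).trace := by
    have : hess n d w = P⁻¹ * (companionMatrix c * P) := by
      rw [hCP, ← Matrix.mul_assoc, Matrix.nonsing_inv_mul _ hu, Matrix.one_mul]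
    rw [this, Matrix.trace_mul_comm, Matrix.mul_assoc, Matrix.mul_nonsing_inv _ hu,
      Matrix.mul_one]
  rw [htr] at ht
  have : (hess n d w).trace = ∑ j ∈ Finset.range n, d j + w 0 := by
    simp only [Matrix.trace, Matrix.diag, hess, Matrix.of_apply]
    rw [Finset.sum_add_distrib, Finset.sum_add_distrib]
    rw [Finset.sum_range]
    have h3 : ∑ x : Fin n, (if (x : ℕ) = 0 then w x else 0) = w 0 := by
      rw [Finset.sum_eq_single ⟨0, by omega⟩]
      · simp
      · intro b _ hb
        have : (b : ℕ) ≠ 0 := fun h => hb (Fin.ext h)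
        simp [this]
      · simp
    rw [h3]
    simp
  rw [this] at ht
  simpa using ht

/-- Transport along a permutation of the basis. -/
lemma aux_perm {F : Type*} [Field F] {n : ℕ} (p k : ℕ) (hn : 3 ≤ n)
    (C P H E V : Matrix (Fin n) (Fin n) F) (hP : IsUnit P.det) (hCP : C * P = P * H)
    (hH : H = E + V) (hE : E ^ p = E) (hV : V ^ (k + 1) = 0) (a : F) (i₁ i₂ : Fin n)
    (hne : i₁ ≠ i₂) (h1 : ∀ i, V i i₁ = 0)
    (h2 : ∀ j, E i₂ j = if j = i₂ then a else 0) :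
    ∃ D E V : Matrix (Fin n) (Fin n) F,
      MatSimilar C D ∧ D = E + V ∧ E ^ p = E ∧ V ^ (k + 1) = 0 ∧
      (∀ i : Fin n, V i ⟨0, by omega⟩ = 0) ∧
      (∀ j : Fin n, E ⟨n - 1, by omega⟩ j =
        if (j : ℕ) = n - 1 then a else 0) := by
  have h0n : (⟨0, by omega⟩ : Fin n) ≠ ⟨n - 1, by omega⟩ := by
    simp only [ne_eq, Fin.mk.injEq]; omega
  obtain ⟨σ, hσ1, hσ2⟩ : ∃ σ : Equiv.Perm (Fin n), σ ⟨0, by omega⟩ = i₁ ∧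
      σ ⟨n - 1, by omega⟩ = i₂ := by
    set τ : Equiv.Perm (Fin n) := Equiv.swap ⟨0, by omega⟩ i₁ with hτ
    have hτ0 : τ ⟨0, by omega⟩ = i₁ := by simp [hτ]
    refine ⟨τ.trans (Equiv.swap (τ ⟨n - 1, by omega⟩) i₂), ?_, ?_⟩
    · simp only [Equiv.trans_apply, hτ0]
      apply Equiv.swap_apply_of_ne_of_ne _ hne
      rw [← hτ0]
      exact fun h => h0n (τ.injective h)
    · simp
  have hpow : ∀ (M : Matrix (Fin n) (Fin n) F) (m : ℕ),
      (M.submatrix σ σ) ^ m = (M ^ m).submatrix σ σ := by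
    intro M m
    have := map_pow (Matrix.reindexAlgEquiv F F σ.symm) M m
    simpa [Matrix.coe_reindexAlgEquiv, Matrix.reindex_apply] using this.symm
  refine ⟨H.submatrix σ σ, E.submatrix σ σ, V.submatrix σ σ, ?_, ?_, ?_, ?_, ?_, ?_⟩
  · have hP' : IsUnit (P.submatrix id σ) := by
      rw [Matrix.isUnit_iff_isUnit_det, Matrix.det_permute']
      exact IsUnit.mul (by simpa using (Units.isUnit (Equiv.Perm.sign σ)).map (Int.castRingHom F)) hP
    obtain ⟨Q, hQ⟩ := hP'
    refine ⟨Q, ?_⟩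
    have : C * (Q : Matrix (Fin n) (Fin n) F) = Q * H.submatrix σ σ := by
      rw [hQ, Matrix.submatrix_mul_equiv, ← hCP]
      rfl
    rw [← this, Units.mul_inv_cancel_right]
  · rw [hH]; rfl
  · rw [hpow, hE]
  · rw [hpow, hV]; rfl
  · intro i
    simp [hσ1, h1]
  · intro j
    simp only [Matrix.submatrix_apply, hσ2, h2]
    have : σ j = i₂ ↔ (j : ℕ) = n - 1 := by
      rw [← hσ2, σ.injective.eq_iff, Fin.ext_iff]
    simp [this]

/-- Standard vectors indexed by naturals (zero out of range). -/
def fvec (F : Type*) [Field F] (n j : ℕ) : Fin n → F := fun i => if (i : ℕ) = j then 1 else 0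

lemma fvec_out (F : Type*) [Field F] {n j : ℕ} (h : n ≤ j) : fvec F n j = 0 := by
  funext i
  have : (i : ℕ) ≠ j := by have := i.2; omega
  simp [fvec, this]

lemma mulVec_fvec {F : Type*} [Field F] {n : ℕ} (M : Matrix (Fin n) (Fin n) F) (j : Fin n) :
    M.mulVec (fvec F n j) = fun i => M i j := by
  funext i
  simp only [Matrix.mulVec, dotProduct, fvec]
  rw [Finset.sum_eq_single j]
  · simp
  · intro b _ hb
    have : (b : ℕ) ≠ j := fun h => hb (Fin.ext h)
    simp [this]
  · simp

lemma ext_fvec {F : Type*} [Field F] {n : ℕ} {A B : Matrix (Fin n) (Fin n) F}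
    (h : ∀ j < n, A.mulVec (fvec F n j) = B.mulVec (fvec F n j)) : A = B := by
  ext i j
  have := h j j.2
  rw [mulVec_fvec, mulVec_fvec] at this
  exact congrFun this i

/-- General shape: diagonal `d`, subdiagonal `s`, first row `w`. -/
def part {F : Type*} [Field F] (n : ℕ) (d s w : ℕ → F) : Matrix (Fin n) (Fin n) F :=
  Matrix.of fun i j => (if (i : ℕ) = j then d j else 0) + (if (i : ℕ) = j + 1 then s j else 0)
    + (if (i : ℕ) = 0 then w j else 0)

lemma part_mulVec {F : Type*} [Field F] {n : ℕ} (d s w : ℕ → F) {j : ℕ} (hj : j < n) :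
    (part n d s w).mulVec (fvec F n j) =
      d j • fvec F n j + s j • fvec F n (j + 1) + w j • fvec F n 0 := by
  have := mulVec_fvec (part n d s w) ⟨j, hj⟩
  simp only at this
  rw [this]
  funext i
  simp [part, fvec]

/-- `v` is killed by a divisor of `X^p - X`. -/
def Kill {F : Type*} [Field F] {n : ℕ} (p : ℕ) (E : Matrix (Fin n) (Fin n) F)
    (Q : Polynomial F) (v : Fin n → F) : Prop :=
  Q ∣ (Polynomial.X ^ p - Polynomial.X) ∧ (Polynomial.aeval E Q).mulVec v = 0

lemma Kill.zero {F : Type*} [Field F] {n : ℕ} (p : ℕ) (E : Matrix (Fin n) (Fin n) F) :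
    Kill p E 1 0 := ⟨one_dvd _, by simp⟩

open Polynomial in
lemma Kill.step {F : Type*} [Field F] {n : ℕ} {p : ℕ} {E : Matrix (Fin n) (Fin n) F}
    {Q : F[X]} {v v1 : Fin n → F} (r : F) (h : Kill p E Q v1) (hr : r ^ p = r)
    (hQ : Q.eval r ≠ 0) (hv : E.mulVec v = r • v + v1) : Kill p E (Q * (X - C r)) v := by
  refine ⟨?_, ?_⟩
  · apply IsCoprime.mul_dvd _ h.1
    · rw [dvd_iff_isRoot]; simp [hr]
    · apply IsCoprime.symm
      rw [(irreducible_X_sub_C r).coprime_iff_not_dvd, dvd_iff_isRoot]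
      exact hQ
  · have : (aeval E (X - C r)).mulVec v = v1 := by
      simp only [map_sub, aeval_X, aeval_C, Matrix.sub_mulVec, hv, Algebra.algebraMap_eq_smul_one,
        Matrix.smul_mulVec, Matrix.one_mulVec]
      simp
    rw [map_mul, ← Matrix.mulVec_mulVec, this, h.2]

open Polynomial in
lemma Kill.pow {F : Type*} [Field F] {n : ℕ} {p : ℕ} {E : Matrix (Fin n) (Fin n) F}
    {Q : F[X]} {v : Fin n → F} (h : Kill p E Q v) : (E ^ p).mulVec v = E.mulVec v := by
  obtain ⟨R, hR⟩ := h.1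
  have h2 : (aeval E (X ^ p - X : F[X])).mulVec v = 0 := by
    rw [hR, mul_comm, map_mul, ← Matrix.mulVec_mulVec, h.2, Matrix.mulVec_zero]
  simp only [map_sub, map_pow, aeval_X, Matrix.sub_mulVec] at h2
  exact sub_eq_zero.mp h2

/-- First scheme. -/
lemma scheme1 {F : Type*} [Field F] (p n k : ℕ) (hn : 3 ≤ n) (hk1 : 1 ≤ k)
    (hk2 : k ≤ n - 1) (hodd : Odd (n - k)) (c : Fin n → F) (d : ℕ → F)
    (htr : (companionMatrix c).trace = ∑ j ∈ Finset.range n, d j)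
    (hd : ∀ j < n, d j ^ p = d j) (hd0 : ∀ j < n, 1 ≤ j → d j ≠ d 0)
    (hpair : ∀ j, j + 1 < n → k ≤ j → Even (j - k) → d j ≠ d (j + 1))
    (r : ℕ) (hr1 : 1 ≤ r) (hrk : r ≤ k) (hrn : r < n - 1) :
    ∃ D E V : Matrix (Fin n) (Fin n) F,
      MatSimilar (companionMatrix c) D ∧ D = E + V ∧ E ^ p = E ∧ V ^ (k + 1) = 0 ∧
      (∀ i : Fin n, V i ⟨0, by omega⟩ = 0) ∧
      (∀ j : Fin n, E ⟨n - 1, by omega⟩ j =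
        if (j : ℕ) = n - 1 then d r else 0) := by
  obtain ⟨w, P, hw0, hP, hCP⟩ := aux_similar hn c d htr
  set sV : ℕ → F := fun j => if k ≤ j ∧ Even (j - k) then 0 else 1 with hsV
  set sE : ℕ → F := fun j => if k ≤ j ∧ Even (j - k) then 1 else 0 with hsE
  have E0 : (part n d sE w).mulVec (fvec F n 0) = d 0 • fvec F n 0 := by
    rw [part_mulVec d sE w (by omega)]
    have : ¬ (k ≤ 0 ∧ Even (0 - k)) := by omega
    simp only [hsE, if_neg this, hw0]
    simp
  refine aux_perm p k hn (companionMatrix c) P (hess n d w) (part n d sE w) (part n 0 sV 0)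
    hP hCP ?_ ?_ ?_ (d r) ⟨n - 1, by omega⟩ ⟨r, by omega⟩ ?_ ?_ ?_
  · ext i j
    simp only [hess, part, Matrix.add_apply, Matrix.of_apply, hsE, hsV, Pi.zero_apply]
    split_ifs <;> ring
  · apply ext_fvec
    intro j hj
    have hEj := part_mulVec d sE w hj
    rcases Nat.eq_zero_or_pos j with rfl | hjpos
    · exact (Kill.step (d 0) (Kill.zero p _) (hd 0 hj) (by simp)
        (by rw [E0, add_zero])).pow
    have K0 : ∀ x : F, Kill p (part n d sE w) _ (x • fvec F n 0) := fun x =>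
      Kill.step (d 0) (Kill.zero p _) (hd 0 (by omega)) (by simp)
        (by rw [Matrix.mulVec_smul, E0, add_zero, smul_comm])
    have h0 := hd0 j hj hjpos
    by_cases hc : (k ≤ j ∧ Even (j - k)) ∧ j + 1 < n
    · have h1 := hpair j hc.2 hc.1.1 hc.1.2
      have h01 := hd0 (j + 1) hc.2 (by omega)
      have hEj1 := part_mulVec d sE w hc.2
      have hc' : ¬ (k ≤ j + 1 ∧ Even (j + 1 - k)) := by
        rintro ⟨_, h⟩
        have := hc.1.2
        rw [show j + 1 - k = (j - k) + 1 by omega] at h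
        exact (Nat.even_add_one.mp h) this
      simp only [hsE, if_pos hc.1, one_smul] at hEj
      simp only [hsE, if_neg hc', zero_smul, add_zero] at hEj1
      rw [add_assoc] at hEj
      refine (Kill.step (d j) (Kill.step (d (j + 1))
        (K0 (w (j + 1) + w j * d 0 - d (j + 1) * w j)) (hd _ hc.2) ?_ ?_) (hd _ hj) ?_ hEj).pow
      · simp [sub_ne_zero, h01]
      · rw [Matrix.mulVec_add, Matrix.mulVec_smul, E0, hEj1]
        module
      · simp [sub_ne_zero, h0, h1]
    · refine (Kill.step (d j) (K0 (w j)) (hd _ hj) (by simp [sub_ne_zero, h0]) ?_).pow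
      rw [hEj]
      by_cases hc1 : (k ≤ j ∧ Even (j - k))
      · have : fvec F n (j + 1) = 0 := fvec_out F (by
          by_contra h; exact hc ⟨hc1, by omega⟩)
        simp [this]
      · simp only [hsE, if_neg hc1]
        simp
  · have hV : ∀ j < n, (part n 0 sV 0).mulVec (fvec F n j) = sV j • fvec F n (j + 1) := by
      intro j hj
      rw [part_mulVec _ _ _ hj]; simp
    have hlow : ∀ m j, j + m = k → ((part n 0 sV 0) ^ (m + 1)).mulVec (fvec F n j) = 0 := by
      intro m
      induction m with
      | zero =>
        intro j hj
        obtain rfl : j = k := by omega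
        rw [zero_add, pow_one, hV _ (by omega)]
        simp [hsV]
      | succ m ih =>
        intro j hj
        rw [pow_succ, ← Matrix.mulVec_mulVec, hV _ (by omega), Matrix.mulVec_smul,
          ih (j + 1) (by omega), smul_zero]
    apply ext_fvec
    intro j hj
    rw [Matrix.zero_mulVec]
    by_cases hjk : j ≤ k
    · rw [show k + 1 = j + ((k - j) + 1) by omega, pow_add, ← Matrix.mulVec_mulVec,
        hlow (k - j) j (by omega), Matrix.mulVec_zero]
    · rw [show k + 1 = (k - 1) + 1 + 1 by omega, pow_succ, pow_succ, ← Matrix.mulVec_mulVec,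
        ← Matrix.mulVec_mulVec, hV _ hj, Matrix.mulVec_smul]
      by_cases hc : k ≤ j ∧ Even (j - k)
      · simp only [hsV, if_pos hc, zero_smul, Matrix.mulVec_zero]
      · by_cases hj1 : j + 1 < n
        · have hc' : (k ≤ j + 1 ∧ Even (j + 1 - k)) := by
            refine ⟨by omega, ?_⟩
            rw [show j + 1 - k = (j - k) + 1 by omega, Nat.even_add_one]
            exact fun h => hc ⟨by omega, h⟩
          rw [hV _ hj1]
          simp only [hsV, if_pos hc', zero_smul, Matrix.mulVec_zero, smul_zero]
        · rw [fvec_out F (by omega)]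
          simp
  · simp only [ne_eq, Fin.mk.injEq]; omega
  · intro i
    have : (i : ℕ) ≠ n - 1 + 1 := by have := i.2; omega
    simp [part, this]
  · intro j
    have h0 : r ≠ 0 := by omega
    simp only [part, Matrix.of_apply, if_neg h0, add_zero, hsE]
    have h2 : r = (j : ℕ) + 1 → ¬ (k ≤ (j : ℕ) ∧ Even ((j : ℕ) - k)) := by
      intro h h'; omega
    simp only [Fin.ext_iff]
    by_cases hjr : (j : ℕ) = r
    · simp [hjr]
    · by_cases h3 : r = (j : ℕ) + 1
      · rw [if_pos h3, if_neg (h2 h3)]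
        simp [hjr, Ne.symm hjr]
      · simp [h3, hjr, Ne.symm hjr]

/-- Second scheme (`k = 1`). -/
lemma scheme2 {F : Type*} [Field F] (p n : ℕ) (hn : 4 ≤ n) (c : Fin n → F) (d : ℕ → F) (a : F)
    (hnev : Even n)
    (htr : (companionMatrix c).trace = ∑ j ∈ Finset.range n, d j)
    (hd : ∀ j < n, d j ^ p = d j) (ha : a ≠ 0) (h2 : (2 : F) ≠ 0)
    (d0 : d 0 = 0) (d1 : d 1 = 2 * a) (d2 : d 2 = a) (d3 : d 3 = - a)
    (de : ∀ j, 4 ≤ j → Even j → d j = a) (dodd : ∀ j, 4 ≤ j → ¬ Even j → d j = 0) :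
    ∃ D E V : Matrix (Fin n) (Fin n) F,
      MatSimilar (companionMatrix c) D ∧ D = E + V ∧ E ^ p = E ∧ V ^ (1 + 1) = 0 ∧
      (∀ i : Fin n, V i ⟨0, by omega⟩ = 0) ∧
      (∀ j : Fin n, E ⟨n - 1, by omega⟩ j =
        if (j : ℕ) = n - 1 then a else 0) := by
  obtain ⟨w, P, hw0, hP, hCP⟩ := aux_similar (by omega) c d htr
  set sV : ℕ → F := fun j => if Even j then 0 else 1 with hsV
  set sE : ℕ → F := fun j => if Even j then 1 else 0 with hsE
  set wV : ℕ → F := fun j => if Even j then 0 else w j with hwV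
  set wE : ℕ → F := fun j => if Even j then w j else 0 with hwE
  have Ee : ∀ j < n, Even j → (part n d sE wE).mulVec (fvec F n j) =
      d j • fvec F n j + (fvec F n (j + 1) + w j • fvec F n 0) := by
    intro j hj he
    rw [part_mulVec d sE wE hj]
    simp only [hsE, hwE, if_pos he, one_smul, add_assoc]
  have Eo : ∀ j < n, ¬ Even j → (part n d sE wE).mulVec (fvec F n j) = d j • fvec F n j := by
    intro j hj he
    rw [part_mulVec d sE wE hj]
    simp only [hsE, hwE, if_neg he, zero_smul, add_zero]
  have E0 : (part n d sE wE).mulVec (fvec F n 0) = fvec F n 1 := by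
    rw [Ee 0 (by omega) (by simp)]; simp [d0, hw0]
  have E1 : (part n d sE wE).mulVec (fvec F n 1) = (2 * a) • fvec F n 1 := by
    rw [Eo 1 (by omega) (by simp), d1]
  have hp0 : (0 : F) ^ p = 0 := by have := hd 0 (by omega); rwa [d0] at this
  have hp1 : (2 * a : F) ^ p = 2 * a := by have := hd 1 (by omega); rwa [d1] at this
  have hp2 : (a : F) ^ p = a := by have := hd 2 (by omega); rwa [d2] at this
  have hp3 : (-a : F) ^ p = -a := by have := hd 3 (by omega); rwa [d3] at this
  have h2a : a - 2 * a ≠ 0 := by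
    intro h; apply ha; linear_combination -h
  have K1 : ∀ x : F, Kill p (part n d sE wE) _ (x • fvec F n 1) := fun x =>
      Kill.step (2 * a) (Kill.zero p _) hp1 (by simp)
        (by rw [Matrix.mulVec_smul, E1, add_zero, smul_comm])
  refine aux_perm p 1 (by omega) (companionMatrix c) P (hess n d w) (part n d sE wE)
    (part n 0 sV wV) hP hCP ?_ ?_ ?_ a ⟨0, by omega⟩ ⟨2, by omega⟩ ?_ ?_ ?_
  · ext i j
    simp only [hess, part, Matrix.add_apply, Matrix.of_apply, hsE, hsV, hwE, hwV, Pi.zero_apply]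
    split_ifs <;> ring
  · apply ext_fvec
    intro j hj
    by_cases he : Even j
    · have hEj := Ee j hj he
      by_cases hj0 : j = 0
      · subst hj0
        refine (Kill.step 0 (K1 1) hp0 ?_ ?_).pow
        · simp [ha, h2]
        · rw [E0]; simp
      have hj1 : j + 1 < n := by
        rcases Nat.lt_or_ge (j + 1) n with h | h
        · exact h
        · exfalso
          rw [show n = j + 1 by omega] at hnev
          exact Nat.even_add_one.mp hnev he
      have hEj1 := Eo (j + 1) hj1 (fun h => Nat.even_add_one.mp h he)
      by_cases hj2 : j = 2
      · subst hj2
        rw [d2] at hEj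
        rw [d3] at hEj1
        by_cases h3 : (3 : F) = 0
        · refine (Kill.step a (Kill.step (-a) (Kill.step 0
            (v := w 2 • (fvec F n 1 + a • fvec F n 0)) (Kill.zero p _) hp0 ?_ ?_) hp3 ?_ ?_)
            hp2 ?_ hEj).pow
          · simp
          · rw [Matrix.mulVec_smul, Matrix.mulVec_add, Matrix.mulVec_smul, E0, E1, ← add_smul,
              show 2 * a + a = 3 * a by ring, h3]
            simp
          · simp [ha]
          · rw [Matrix.mulVec_add, Matrix.mulVec_smul, E0, hEj1]
            module
          · simp [ha]
            intro h
            have : 2 * a = 0 := by linear_combination h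
            simp [ha, h2] at this
        · refine (Kill.step a (Kill.step (-a) (Kill.step 0
            (v := w 2 • (fvec F n 1 + a • fvec F n 0)) (K1 (w 2 * (3 * a))) hp0 ?_ ?_) hp3 ?_ ?_)
            hp2 ?_ hEj).pow
          · simp [ha, h2]
          · rw [Matrix.mulVec_smul, Matrix.mulVec_add, Matrix.mulVec_smul, E0, E1]
            module
          · simp [ha]
            intro h
            have : 3 * a = 0 := by linear_combination -h
            simp [ha, h3] at this
          · rw [Matrix.mulVec_add, Matrix.mulVec_smul, E0, hEj1]
            module
          · simp [ha, h2a]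
            intro h
            have : 2 * a = 0 := by linear_combination h
            simp [ha, h2] at this
      · have hj4 : 4 ≤ j := by
          rcases he with ⟨m, hm⟩; omega
        rw [de j hj4 he] at hEj
        rw [dodd (j + 1) (by omega) (fun h => Nat.even_add_one.mp h he), zero_smul] at hEj1
        refine (Kill.step a (Kill.step 0 (K1 (w j)) hp0 ?_ ?_) hp2 ?_ hEj).pow
        · simp [ha, h2]
        · rw [Matrix.mulVec_add, Matrix.mulVec_smul, E0, hEj1]
          simp
        · simp [ha, h2a]
    · exact (Kill.step (d j) (Kill.zero p _) (hd j hj) (by simp)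
        (by rw [Eo j hj he, add_zero])).pow
  · have Ve : ∀ j, Even j → (part n 0 sV wV).mulVec (fvec F n j) = 0 := by
      intro j he
      by_cases hj : j < n
      · rw [part_mulVec _ _ _ hj]
        simp [hsV, hwV, if_pos he]
      · rw [fvec_out F (by omega), Matrix.mulVec_zero]
    apply ext_fvec
    intro j hj
    rw [Matrix.zero_mulVec, pow_succ, pow_one, ← Matrix.mulVec_mulVec]
    by_cases he : Even j
    · rw [Ve j he, Matrix.mulVec_zero]
    · rw [part_mulVec _ _ _ hj, Matrix.mulVec_add, Matrix.mulVec_add, Matrix.mulVec_smul,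
        Matrix.mulVec_smul, Matrix.mulVec_smul, Ve _ (Nat.even_add_one.mpr he), Ve 0 (by simp)]
      simp
  · simp
  · intro i
    simp [part, hsV, hwV]
  · intro j
    simp only [Fin.ext_iff]
    simp only [part, Matrix.of_apply, hsE]
    by_cases hj2 : (j : ℕ) = 2
    · simp [hj2, d2]
    · by_cases h1 : (j : ℕ) = 1
      · simp [h1]
      · have : 2 ≠ (j : ℕ) + 1 := by omega
        simp [hj2, Ne.symm hj2]
        omega

/-- Diagonal for the first scheme. -/
def diagA {F : Type*} [Field F] (k : ℕ) (e a : F) (j : ℕ) : F :=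
  if j = 0 then e else if k < j ∧ Odd (j - k) then 0 else a

lemma diagA_sum {F : Type*} [Field F] (k : ℕ) (e a : F) (q : ℕ) :
    ∑ j ∈ Finset.range (k + 1 + 2 * q), diagA k e a j = e + (k + q : ℕ) * a := by
  induction q with
  | zero =>
    rw [mul_zero, add_zero, Finset.sum_range_succ', add_zero]
    have : ∀ j ∈ Finset.range k, diagA k e a (j + 1) = a := by
      intro j hj
      have := Finset.mem_range.mp hj
      have h : ¬ (k < j + 1 ∧ Odd (j + 1 - k)) := by omega
      simp only [diagA, if_neg h, if_neg (Nat.succ_ne_zero _)]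
    rw [Finset.sum_congr rfl this]
    simp [diagA, add_comm]
  | succ q ih =>
    rw [show k + 1 + 2 * (q + 1) = k + 1 + 2 * q + 1 + 1 by ring, Finset.sum_range_succ,
      Finset.sum_range_succ, ih]
    have h1 : k < k + 1 + 2 * q ∧ Odd (k + 1 + 2 * q - k) :=
      ⟨by omega, ⟨q, by omega⟩⟩
    have h2 : ¬ (k < k + 1 + 2 * q + 1 ∧ Odd (k + 1 + 2 * q + 1 - k)) := by
      rintro ⟨_, m, hm⟩; omega
    have h3 : k + 1 + 2 * q ≠ 0 := by omega
    simp only [diagA, if_neg h3, if_pos h1, if_neg h2, if_neg (Nat.succ_ne_zero _)]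
    push_cast; ring

/-- Diagonal for the second scheme. -/
def diagC {F : Type*} [Field F] (a : F) (j : ℕ) : F :=
  if j = 0 then 0 else if j = 1 then 2 * a else if j = 3 then - a else
    if Even j then a else 0

lemma diagC_sum {F : Type*} [Field F] (a : F) (m : ℕ) :
    ∑ j ∈ Finset.range (4 + 2 * m), diagC a j = (m + 2 : ℕ) * a := by
  induction m with
  | zero =>
    simp [Finset.sum_range_succ, diagC]
  | succ m ih =>
    rw [show 4 + 2 * (m + 1) = 4 + 2 * m + 1 + 1 by ring, Finset.sum_range_succ,
      Finset.sum_range_succ, ih]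
    have h1 : Even (4 + 2 * m) := ⟨2 + m, by ring⟩
    have h2 : ¬ Even (4 + 2 * m + 1) := fun h => Nat.even_add_one.mp h h1
    have e1 : 4 + 2 * m ≠ 0 := by omega
    have e2 : 4 + 2 * m ≠ 1 := by omega
    have e3 : 4 + 2 * m ≠ 3 := by omega
    have e4 : 4 + 2 * m + 1 ≠ 0 := by omega
    have e5 : 4 + 2 * m + 1 ≠ 1 := by omega
    have e6 : 4 + 2 * m + 1 ≠ 3 := by omega
    simp only [diagC, if_neg e1, if_neg e2, if_neg e3, if_neg e4, if_neg e5, if_neg e6,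
      if_pos h1, if_neg h2]
    push_cast; ring

theorem stmt_13 {F : Type*} [Field F] (p : ℕ) [Fact p.Prime] (hp : Odd p)
    [CharP F p] (n k a l : ℕ) (hn : 3 ≤ n)
    (ha1 : 1 ≤ a) (ha2 : a ≤ p - 1) (hk1 : 1 ≤ k) (hk2 : k ≤ n - 1)
    (hodd : Odd (n - k)) (hl1 : 1 ≤ l) (hl2 : l ≤ p - 1)
    (c : Fin n → F) (C : Matrix (Fin n) (Fin n) F) (hC : C = companionMatrix c)
    (htr : C.trace = ((((n + k + 1) / 2 * a : ℕ) : ℤ) - (l : ℤ) : ℤ)) :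
    ∃ D E V : Matrix (Fin n) (Fin n) F,
      MatSimilar C D ∧ D = E + V ∧ E ^ p = E ∧ V ^ (k + 1) = 0 ∧
      (∀ i : Fin n, V i ⟨0, by omega⟩ = 0) ∧
      (∀ j : Fin n, E ⟨n - 1, by omega⟩ j =
        if (j : ℕ) = n - 1 then (a : F) else 0) := by
  subst hC
  have hpp : p.Prime := Fact.out
  have hp0 : p ≠ 0 := hpp.ne_zero
  have hcast : ∀ m : ℕ, 1 ≤ m → m < p → (m : F) ≠ 0 := by
    intro m h1 h2 h
    rw [CharP.cast_eq_zero_iff F p] at h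
    have := Nat.le_of_dvd (by omega) h
    omega
  have hp3 : 3 ≤ p := by
    have := hpp.two_le
    obtain ⟨m, hm⟩ := hp
    omega
  have haF : (a : F) ≠ 0 := hcast a ha1 (by omega)
  have hlF : (l : F) ≠ 0 := hcast l hl1 (by omega)
  have h2F : (2 : F) ≠ 0 := by exact_mod_cast hcast 2 (by omega) (by omega)
  have hpow : ∀ z : ℤ, (z : F) ^ p = z := by
    intro z
    have := map_intCast (frobenius F p) z
    rwa [frobenius_def] at this
  have hpa : (a : F) ^ p = a := by simpa using hpow a
  have hpz : (0 : F) ^ p = 0 := zero_pow hp0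
  obtain ⟨q, hq⟩ : ∃ q, n = k + 1 + 2 * q := by
    obtain ⟨m, hm⟩ := hodd
    exact ⟨m, by omega⟩
  have hdiv : (n + k + 1) / 2 = k + 1 + q := by omega
  rw [hdiv] at htr
  by_cases hA : q = 0 ∨ (l : F) ≠ a
  · have key := scheme1 p n k hn hk1 hk2 hodd c (diagA k ((a : F) - l) a) ?_ ?_ ?_ ?_ 1 le_rfl
      hk1 (by omega)
    · have h1 : ¬ (k < 1 ∧ Odd (1 - k)) := by omega
      have hr : diagA k ((a : F) - l) a 1 = a := by
        simp only [diagA, if_neg h1, if_neg one_ne_zero]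
      rw [hr] at key
      exact key
    · rw [htr]
      conv_rhs => rw [hq]
      rw [diagA_sum]
      push_cast; ring
    · intro j hj
      have := hpow ((a : ℤ) - l)
      push_cast at this
      simp only [diagA]
      split_ifs <;> assumption
    · intro j hj hj1
      have hj0 : j ≠ 0 := by omega
      simp only [diagA, if_neg hj0, if_true]
      split_ifs with h
      · rcases hA with hA | hA
        · omega
        · intro h'
          apply hA
          linear_combination h'
      · intro h'
        apply hlF
        linear_combination h'
    · intro j hj hkj hev
      have hj0 : j ≠ 0 := by omega
      have h1 : ¬ (k < j ∧ Odd (j - k)) := fun h => (Nat.not_odd_iff_even.mpr hev) h.2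
      have h2 : k < j + 1 ∧ Odd (j + 1 - k) := by
        refine ⟨by omega, ?_⟩
        rw [show j + 1 - k = (j - k) + 1 by omega]
        exact hev.add_one
      simp only [diagA, if_neg hj0, if_neg h1, if_neg (Nat.succ_ne_zero _), if_pos h2]
      exact haF
  · push Not at hA
    obtain ⟨hq0, hla⟩ := hA
    by_cases hk : k = 1
    · subst hk
      obtain ⟨m, rfl⟩ : ∃ m, q = m + 1 := ⟨q - 1, by omega⟩
      have hev : Even n := ⟨m + 2, by omega⟩
      refine scheme2 p n (by omega) c (diagC (a : F)) a hev ?_ ?_ haF h2F ?_ ?_ ?_ ?_ ?_ ?_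
      · rw [htr]
        conv_rhs => rw [show n = 4 + 2 * m by omega]
        rw [diagC_sum]
        push_cast
        rw [hla]; ring
      · intro j hj
        have h1 := hpow (2 * (a : ℤ))
        have h2 := hpow (- (a : ℤ))
        push_cast at h1 h2
        simp only [diagC]
        split_ifs <;> assumption
      · simp [diagC]
      · simp [diagC]
      · simp [diagC]
      · simp [diagC]
      · intro j hj he
        have e1 : j ≠ 0 := by omega
        have e2 : j ≠ 1 := by omega
        have e3 : j ≠ 3 := by omega
        simp [diagC, e1, e2, e3, he]
      · intro j hj he
        have e1 : j ≠ 0 := by omega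
        have e2 : j ≠ 1 := by omega
        have e3 : j ≠ 3 := by omega
        simp only [diagC, e1, e2, e3, he, if_false]
    · have hk' : 2 ≤ k := by omega
      have dval : ∀ j, 1 ≤ j → j = 1 ∨ j = n - 1 → diagA k (2 * (a : F)) a j = a := by
        intro j hj1 hj
        have hj0 : j ≠ 0 := by omega
        have h1 : ¬ (k < j ∧ Odd (j - k)) := by
          rintro ⟨h, m, hm⟩
          omega
        simp only [diagA, if_neg hj0, if_neg h1]
      have key := scheme1 p n k hn hk1 hk2 hodd c
        (fun j => if j = 1 ∨ j = n - 1 then 0 else diagA k (2 * (a : F)) a j)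
        ?_ ?_ ?_ ?_ k hk1 le_rfl (by omega)
      · have h1 : ¬ (k = 1 ∨ k = n - 1) := by omega
        have h0 : k ≠ 0 := by omega
        have hr : diagA k (2 * (a : F)) a k = a := by simp [diagA, h0]
        simp only [if_neg h1, hr] at key
        exact key
      · have hs : ∀ j ∈ Finset.range n,
            (if j = 1 ∨ j = n - 1 then 0 else diagA k (2 * (a : F)) a j) =
              diagA k (2 * (a : F)) a j - (if j = 1 then (a : F) else 0)
                - (if j = n - 1 then (a : F) else 0) := by
          intro j _
          by_cases h1 : j = 1
          · have : (1 : ℕ) ≠ n - 1 := by omega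
            subst h1
            simp [this, dval 1 le_rfl (Or.inl rfl)]
          · by_cases h2 : j = n - 1
            · simp only [h2, or_true, if_true, dval (n - 1) (by omega) (Or.inr rfl)]
              rw [if_neg (by omega)]; ring
            · simp [h1, h2]
        rw [Finset.sum_congr rfl hs, Finset.sum_sub_distrib, Finset.sum_sub_distrib,
          Finset.sum_ite_eq', Finset.sum_ite_eq', if_pos (Finset.mem_range.mpr (by omega)),
          if_pos (Finset.mem_range.mpr (by omega)), htr]
        have := diagA_sum k (2 * (a : F)) a q
        rw [← hq] at this
        rw [this]
        push_cast
        rw [hla]; ring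
      · intro j hj
        have h1 := hpow (2 * (a : ℤ))
        push_cast at h1
        simp only [diagA]
        split_ifs <;> assumption
      · intro j hj hj1
        have hj0 : j ≠ 0 := by omega
        have h0 : ¬ (0 = 1 ∨ 0 = n - 1) := by omega
        simp only [diagA, if_neg hj0, if_true, if_neg h0]
        have hz : (0 : F) ≠ 2 * a := (mul_ne_zero h2F haF).symm
        split_ifs
        · exact hz
        · exact hz
        · intro h'
          apply haF
          linear_combination -h'
      · intro j hj hkj hev
        have hj0 : j ≠ 0 := by omega
        have h1 : ¬ (k < j ∧ Odd (j - k)) := fun h => (Nat.not_odd_iff_even.mpr hev) h.2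
        have h2 : k < j + 1 ∧ Odd (j + 1 - k) := by
          refine ⟨by omega, ?_⟩
          rw [show j + 1 - k = (j - k) + 1 by omega]
          exact hev.add_one
        have h3 : ¬ (j = 1 ∨ j = n - 1) := by omega
        simp only [diagA, if_neg hj0, if_neg h1, if_neg (Nat.succ_ne_zero _), if_pos h2,
          if_neg h3, ite_self]
        exact haF
end

section
/- Let F be a field of odd characteristic p, n ≥ 3, k a positive integer with n−k odd, and C ∈ M_n(F) a companion matrix with Tr(C) = t·1_F, t ∈ {0,…,p−1}, and (n+k+1)/2 · 1_F ≠ 0. Then there exist D, E, V with C similar to D = E + V, E^p = E, the last row of E equal to (0,…,0,a) for some a ∈ {1,…,p−1}, V^{k+1} = 0, and the first column of V zero. -/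
open Matrix Polynomial

lemma exists_frame {F : Type*} [Field F] {n : ℕ} (i0 i1 : Fin n) (h01 : i0 ≠ i1)
    (v φ : Fin n → F) (hv : v ≠ 0) (hφ : φ ≠ 0) (h : φ ⬝ᵥ v = 0) :
    ∃ R : (Matrix (Fin n) (Fin n) F)ˣ, (R : Matrix (Fin n) (Fin n) F) *ᵥ Pi.single i0 1 = v ∧
      φ ᵥ* (R : Matrix (Fin n) (Fin n) F) = Pi.single i1 1 := by
  classical
  let f : Module.Dual F (Fin n → F) := dotProductEquiv F (Fin n) φ
  have hf : f ≠ 0 := by simpa [f] using hφ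
  have hfv : f v = 0 := by simpa [f] using h
  obtain ⟨s, b, i, j, hij, hvi, hfj⟩ := exists_basis_of_pairing_eq_zero hfv hf hv
  have : Fintype s := FiniteDimensional.fintypeBasisIndex b
  have hcard : Fintype.card s = n := by
    rw [← Module.finrank_eq_card_basis b]; simp
  let e0 : s ≃ Fin n := Fintype.equivFinOfCardEq hcard
  have hij' : e0 i ≠ e0 j := fun hh => hij (e0.injective hh)
  obtain ⟨σ, hσ⟩ := Equiv.Perm.exists_extending_pair ![e0 i, e0 j] ![i0, i1]
    (by intro x y; fin_cases x <;> fin_cases y <;> simp [hij', hij'.symm])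
    (by intro x y; fin_cases x <;> fin_cases y <;> simp [h01, h01.symm])
  have hσ0 : σ (e0 i) = i0 := hσ 0
  have hσ1 : σ (e0 j) = i1 := hσ 1
  let b' : Module.Basis (Fin n) F (Fin n → F) := b.reindex (e0.trans σ)
  have hb0 : b' i0 = v := by
    simp [b', ← hσ0, hvi]
  have hb1 : ∀ l, φ ⬝ᵥ b' l = if l = i1 then 1 else 0 := by
    intro l
    have : φ ⬝ᵥ b' l = f (b' l) := by simp [f]
    rw [this, hfj]
    simp only [b', Module.Basis.reindex_apply, Module.Basis.coord_apply, Module.Basis.repr_self,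
      Finsupp.single_apply]
    congr 1
    simp [Equiv.symm_apply_eq, ← hσ1]
  have hdet : IsUnit ((Pi.basisFun F (Fin n)).toMatrix b') := by
    have := Module.Basis.invertibleToMatrix (Pi.basisFun F (Fin n)) b'
    exact isUnit_of_invertible _
  obtain ⟨R, hR⟩ := hdet
  have hRe : ∀ l m, (R : Matrix (Fin n) (Fin n) F) l m = b' m l := by
    intro l m; rw [hR]; simp [Module.Basis.toMatrix_apply]
  refine ⟨R, ?_, ?_⟩
  · ext l
    simp [hRe, hb0]
  · ext l
    simp only [vecMul, Pi.single_apply]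
    rw [← hb1 l]
    congr 1
    ext m; exact hRe m l

lemma exists_hessenberg {F : Type*} [Field F] {n : ℕ} (hn : 1 ≤ n) (c : Fin n → F)
    (d : Fin n → F) (hd : (companionMatrix c).trace = ∑ i, d i) :
    ∃ (D : Matrix (Fin n) (Fin n) F), MatSimilar (companionMatrix c) D ∧
      (∀ i j : Fin n, (j : ℕ) + 1 < n →
        D i j = if i = j then d j else if (i : ℕ) = j + 1 then 1 else 0) ∧
      (∀ j : Fin n, D j j = d j) := by
  classical
  set C := companionMatrix c with hC
  let d' : ℕ → F := fun i => if h : i < n then d ⟨i, h⟩ else 0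
  let b : ℕ → Fin n → F := fun i => Nat.rec (Pi.single ⟨0, hn⟩ 1)
    (fun i x => C *ᵥ x - d' i • x) i
  have hb0 : b 0 = Pi.single ⟨0, hn⟩ 1 := rfl
  have hbs : ∀ i, b (i+1) = C *ᵥ (b i) - d' i • b i := fun i => rfl
  have hb : ∀ i, i < n → (∀ j : Fin n, i < (j : ℕ) → b i j = 0) ∧
      (∀ j : Fin n, (j : ℕ) = i → b i j = 1) := by
    intro i
    induction i with
    | zero =>
      intro _
      refine ⟨fun j hj => ?_, fun j hj => ?_⟩
      · rw [hb0, Pi.single_eq_of_ne]; intro h; subst h; simp at hj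
      · rw [hb0]; have : j = ⟨0, hn⟩ := Fin.ext hj
        subst this; simp
    | succ i ih =>
      intro hi
      obtain ⟨h1, h2⟩ := ih (by omega)
      have key : ∀ j : Fin n, ∀ hj : 0 < (j : ℕ), i < (j : ℕ) →
          (C *ᵥ (b i)) j = b i ⟨j - 1, by omega⟩ := by
        intro j hj hij
        simp only [mulVec, dotProduct]
        rw [Finset.sum_eq_single (⟨(j : ℕ) - 1, by omega⟩ : Fin n)]
        · simp only [hC, companionMatrix, of_apply]
          rw [if_neg (by omega), if_pos (by omega), one_mul]
        · intro l _ hl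
          by_cases hli : i < (l : ℕ)
          · rw [h1 l hli, mul_zero]
          · simp only [hC, companionMatrix, of_apply]
            rw [if_neg (by omega), if_neg, zero_mul]
            intro h; apply hl; apply Fin.ext; simp; omega
        · simp
      refine ⟨fun j hj => ?_, fun j hj => ?_⟩
      · rw [hbs, Pi.sub_apply, Pi.smul_apply, key j (by omega) (by omega), h1 _ (by simp; omega),
          h1 j (by omega)]; simp
      · rw [hbs, Pi.sub_apply, Pi.smul_apply, key j (by omega) (by omega), h2 _ (by simp; omega),
          h1 j (by omega)]; simp
  let P : Matrix (Fin n) (Fin n) F := of fun i j => b j i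
  have hPdet : P.det = 1 := by
    rw [det_of_isUpperTriangular]
    · apply Finset.prod_eq_one; intro i _; exact (hb i i.2).2 i rfl
    · intro i j hij; exact (hb j j.2).1 i hij
  have hPu : IsUnit P := by rw [isUnit_iff_isUnit_det, hPdet]; exact isUnit_one
  obtain ⟨U, hU⟩ := hPu
  have hPcol : ∀ j : Fin n, P *ᵥ Pi.single j 1 = b j := by
    intro j; ext i; simp [P]
  have hUi : ∀ j : Fin n, (↑U⁻¹ : Matrix (Fin n) (Fin n) F) *ᵥ b j = Pi.single j 1 := by
    intro j
    rw [← hPcol, ← hU, mulVec_mulVec, Units.inv_mul, one_mulVec]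
  let D := (↑U⁻¹ : Matrix (Fin n) (Fin n) F) * C * (U : Matrix (Fin n) (Fin n) F)
  have hD1 : ∀ i j : Fin n, (j : ℕ) + 1 < n →
        D i j = if i = j then d j else if (i : ℕ) = j + 1 then 1 else 0 := by
    intro i j hj
    have h1 : D *ᵥ Pi.single j 1 = d j • Pi.single j 1 + Pi.single (⟨j+1, hj⟩ : Fin n) 1 := by
      have : C *ᵥ b j = d j • b j + b (j+1) := by
        rw [hbs]; simp [d']
      simp only [D]
      rw [← mulVec_mulVec, hU, hPcol, ← mulVec_mulVec, this, mulVec_add, mulVec_smul, hUi]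
      congr 1
      exact hUi ⟨j+1, hj⟩
    have h2 : D i j = (D *ᵥ Pi.single j 1) i := by simp
    rw [h2, h1]
    simp only [Pi.add_apply, Pi.smul_apply, Pi.single_apply, smul_eq_mul, Fin.ext_iff]
    by_cases h : (i : ℕ) = j
    · simp [h]
    · simp [h]
  have htr : D.trace = C.trace := by
    simp only [D]
    rw [trace_mul_comm, ← mul_assoc, Units.mul_inv, one_mul]
  refine ⟨D, ⟨U, ?_⟩, hD1, ?_⟩
  · simp only [D]
    simp [mul_assoc]
  · have hne : ∀ j : Fin n, j ≠ ⟨n-1, by omega⟩ → D j j = d j := by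
      intro j hj
      rw [hD1 j j, if_pos rfl]
      have := j.2
      by_contra h
      apply hj; apply Fin.ext; simp; omega
    intro j
    by_cases hj : j = ⟨n-1, by omega⟩
    · subst hj
      rw [hd, trace] at htr
      rw [← Finset.add_sum_erase _ _ (Finset.mem_univ (⟨n-1, by omega⟩ : Fin n)),
        ← Finset.add_sum_erase _ d (Finset.mem_univ (⟨n-1, by omega⟩ : Fin n))] at htr
      rw [Finset.sum_congr rfl (f := D.diag) (g := d) (fun x hx => hne x (Finset.ne_of_mem_erase hx))] at htr
      exact add_right_cancel htr
    · exact hne j hj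

lemma exists_kernel_vec {F : Type*} [Field F] {n : ℕ} (hn : 3 ≤ n)
    (V : Matrix (Fin n) (Fin n) F) (hV : V * V = 0) (φ : Fin n → F) :
    ∃ v : Fin n → F, v ≠ 0 ∧ V *ᵥ v = 0 ∧ φ ⬝ᵥ v = 0 := by
  let T := V.mulVecLin
  have h1 := T.finrank_range_add_finrank_ker
  have h2 : LinearMap.range T ≤ LinearMap.ker T := by
    rintro _ ⟨x, rfl⟩
    simp [T, hV]
  have h3 := Submodule.finrank_mono h2
  rw [Module.finrank_fin_fun] at h1
  let f : LinearMap.ker T →ₗ[F] F := (dotProductEquiv F (Fin n) φ).comp (LinearMap.ker T).subtype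
  have h4 : LinearMap.ker f ≠ ⊥ := by
    apply LinearMap.ker_ne_bot_of_finrank_lt
    rw [Module.finrank_self]; omega
  obtain ⟨v, hv, hv0⟩ := Submodule.exists_mem_ne_zero_of_ne_bot h4
  refine ⟨v, by simpa using hv0, ?_, ?_⟩
  · exact v.2
  · simpa [f] using hv

lemma pot_of_dvd {F : Type*} [Field F] {n : ℕ} (p : ℕ) (E : Matrix (Fin n) (Fin n) F)
    (q : F[X]) (hq : q ∣ X ^ p - X) (w : Fin n → F) (hw : aeval E q *ᵥ w = 0) :
    (E ^ p - E) *ᵥ w = 0 := by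
  obtain ⟨r, hr⟩ := hq
  have h : E ^ p - E = aeval E (X ^ p - X : F[X]) := by simp
  rw [h, hr, mul_comm, map_mul, ← mulVec_mulVec, hw, mulVec_zero]

lemma dvd_pot1 {F : Type*} [Field F] (p : ℕ) (x : F) (hx : x ^ p = x) :
    (X - C x) ∣ (X ^ p - X : F[X]) := by
  rw [dvd_iff_isRoot]; simp [hx]

lemma cop {F : Type*} [Field F] {x y : F} (h : x ≠ y) : IsCoprime (X - C x) (X - C y) :=
  isCoprime_X_sub_C_of_isUnit_sub (sub_ne_zero.2 h).isUnit

lemma aeval_sub_vec {F : Type*} [Field F] {n : ℕ} (E : Matrix (Fin n) (Fin n) F) (x : F)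
    (w : Fin n → F) : aeval E (X - C x) *ᵥ w = E *ᵥ w - x • w := by
  simp [sub_mulVec, Algebra.algebraMap_eq_smul_one, smul_mulVec]

lemma pot_vec1 {F : Type*} [Field F] {n : ℕ} (p : ℕ) (E : Matrix (Fin n) (Fin n) F)
    {x : F} (hx : x ^ p = x) {u : Fin n → F} (hu : E *ᵥ u = x • u) :
    (E ^ p - E) *ᵥ u = 0 := by
  apply pot_of_dvd p E _ (dvd_pot1 p x hx)
  rw [aeval_sub_vec, hu, sub_self]

lemma pot_vec2 {F : Type*} [Field F] {n : ℕ} (p : ℕ) (E : Matrix (Fin n) (Fin n) F)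
    {x y : F} (hx : x ^ p = x) (hy : y ^ p = y) (hxy : x ≠ y)
    {u v : Fin n → F} (hu : E *ᵥ u = x • u) (hv : E *ᵥ v = y • v + u) :
    (E ^ p - E) *ᵥ v = 0 := by
  apply pot_of_dvd p E ((X - C x) * (X - C y))
    ((cop hxy).mul_dvd (dvd_pot1 p x hx) (dvd_pot1 p y hy))
  rw [map_mul, ← mulVec_mulVec, aeval_sub_vec E y, hv, add_sub_cancel_left, aeval_sub_vec, hu,
    sub_self]

lemma pot_vec3 {F : Type*} [Field F] {n : ℕ} (p : ℕ) (E : Matrix (Fin n) (Fin n) F)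
    {x y z : F} (hx : x ^ p = x) (hy : y ^ p = y) (hz : z ^ p = z) (hxy : x ≠ y)
    (hxz : x ≠ z) (hyz : y ≠ z)
    {u v w : Fin n → F} (hu : E *ᵥ u = x • u) (hv : E *ᵥ v = y • v + u)
    (hw : E *ᵥ w = z • w + v) :
    (E ^ p - E) *ᵥ w = 0 := by
  apply pot_of_dvd p E ((X - C x) * (X - C y) * (X - C z))
    (((cop hxz).mul_left (cop hyz)).mul_dvd
      ((cop hxy).mul_dvd (dvd_pot1 p x hx) (dvd_pot1 p y hy)) (dvd_pot1 p z hz))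
  rw [map_mul, map_mul, ← mulVec_mulVec, ← mulVec_mulVec, aeval_sub_vec E z, hw,
    add_sub_cancel_left, aeval_sub_vec E y, hv, add_sub_cancel_left, aeval_sub_vec, hu,
    sub_self]

/-- The potent part of the Hessenberg matrix. -/
def potPart {F : Type*} [Field F] {n : ℕ} (D : Matrix (Fin n) (Fin n) F) (d : Fin n → F) :
    Matrix (Fin n) (Fin n) F := of fun i j =>
  if (j : ℕ) + 1 < n then
    (if i = j then d j else if (i : ℕ) = j + 1 ∧ (n - 1 - j) % 2 = 1 then 1 else 0)
  else (if i = j then d j else if (n - 1 - i) % 2 = 0 then D i j else 0)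

lemma potPart_pow {F : Type*} [Field F] {n : ℕ} (hn : 3 ≤ n) (p : ℕ)
    (D : Matrix (Fin n) (Fin n) F) (d : Fin n → F) (β : F) (hβ : β ^ p = β)
    (hd : ∀ j, d j ^ p = d j)
    (h0 : ∀ j : Fin n, (j : ℕ) + 1 < n → (n - 1 - j) % 2 = 0 → d j = β)
    (h1 : ∀ j : Fin n, (n - 1 - j) % 2 = 1 → d j ≠ β)
    (h2 : d ⟨n - 1, by omega⟩ ≠ β) (h3 : d ⟨n - 1, by omega⟩ ≠ d ⟨n - 2, by omega⟩) :
    potPart D d ^ p = potPart D d := by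
  set E := potPart D d with hE
  have hodd : ∀ j : Fin n, ∀ hj : (j : ℕ) + 1 < n, (n - 1 - j) % 2 = 1 →
      E *ᵥ Pi.single j 1 = d j • Pi.single j 1 + Pi.single (⟨j + 1, hj⟩ : Fin n) 1 := by
    intro j hj hjo
    ext i
    simp only [mulVec_single_one, col_apply, hE, potPart, of_apply, Pi.add_apply, Pi.smul_apply,
      Pi.single_apply, smul_eq_mul, if_pos hj, hjo, Fin.ext_iff]
    by_cases h : (i : ℕ) = j
    · simp [h]
    · simp [h]
  have heven : ∀ j : Fin n, (j : ℕ) + 1 < n → (n - 1 - j) % 2 = 0 →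
      E *ᵥ Pi.single j 1 = β • Pi.single j 1 := by
    intro j hj hjo
    ext i
    simp only [mulVec_single_one, col_apply, hE, potPart, of_apply, Pi.smul_apply,
      Pi.single_apply, smul_eq_mul, if_pos hj, hjo, h0 j hj hjo]
    simp
  let la : Fin n := ⟨n - 1, by omega⟩
  let U : Fin n → F := fun i => if (i : ℕ) + 1 < n ∧ (n - 1 - i) % 2 = 0 then D i la else 0
  have hU : E *ᵥ U = β • U := by
    ext i
    simp only [mulVec, dotProduct, Pi.smul_apply, smul_eq_mul]
    rw [Finset.sum_eq_single i]
    · by_cases h : (i : ℕ) + 1 < n ∧ (n - 1 - i) % 2 = 0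
      · simp only [hE, potPart, of_apply, if_pos h.1, if_true, h0 i h.1 h.2]
      · simp only [U, if_neg h, mul_zero]
    · intro l _ hl
      by_cases h : (l : ℕ) + 1 < n ∧ (n - 1 - l) % 2 = 0
      · simp only [hE, potPart, of_apply, if_pos h.1, if_neg hl.symm, h.2]
        simp
      · simp only [U, if_neg h, mul_zero]
    · simp
  have hla : E *ᵥ Pi.single la 1 = d la • Pi.single la 1 + U := by
    ext i
    have hnl : ¬ ((la : ℕ) + 1 < n) := by simp [la]; omega
    simp only [mulVec_single_one, col_apply, hE, potPart, of_apply, Pi.add_apply, Pi.smul_apply,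
      Pi.single_apply, smul_eq_mul, if_neg hnl, U]
    by_cases h : i = la
    · subst h; simp [hnl]
    · have : (i : ℕ) + 1 < n := by
        have := i.2
        have h' : (i : ℕ) ≠ n - 1 := fun hh => h (Fin.ext hh)
        omega
      simp [h, this]
  have key : ∀ j : Fin n, (E ^ p - E) *ᵥ Pi.single j 1 = 0 := by
    intro j
    have hjn := j.2
    by_cases hj : (j : ℕ) + 1 < n
    · rcases Nat.mod_two_eq_zero_or_one (n - 1 - j) with he | ho
      · exact pot_vec1 p E hβ (heven j hj he)
      · by_cases hj2 : (j : ℕ) + 2 < n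
        · have := heven ⟨j + 1, hj⟩ (by simp; omega) (by simp; omega)
          exact pot_vec2 p E hβ (hd j) (h1 j ho).symm this (hodd j hj ho)
        · have hj3 : j = ⟨n - 2, by omega⟩ := by apply Fin.ext; simp; omega
          have hs : (⟨(j : ℕ) + 1, hj⟩ : Fin n) = la := by apply Fin.ext; simp [la]; omega
          have hw := hodd j hj ho
          rw [hs] at hw
          exact pot_vec3 p E hβ (hd la) (hd j) h2.symm (h1 j ho).symm (by rw [hj3]; exact h3)
            hU hla hw
    · have hs : j = la := by apply Fin.ext; simp [la]; omega
      rw [hs]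
      exact pot_vec2 p E hβ (hd la) h2.symm hU hla
  rw [← sub_eq_zero]
  ext i j
  have := congrFun (key j) i
  simpa using this

lemma nilPart_sq {F : Type*} [Field F] {n : ℕ} (hn : 3 ≤ n)
    (D : Matrix (Fin n) (Fin n) F) (d : Fin n → F)
    (hD : ∀ i j : Fin n, (j : ℕ) + 1 < n →
        D i j = if i = j then d j else if (i : ℕ) = j + 1 then 1 else 0)
    (hD2 : ∀ j : Fin n, D j j = d j) :
    (D - potPart D d) * (D - potPart D d) = 0 := by
  have key : ∀ i j : Fin n, ¬ ((n - 1 - j) % 2 = 0 ∧ (n - 1 - i) % 2 = 1) →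
      (D - potPart D d) i j = 0 := by
    intro i j h
    have hi := i.2
    have hj := j.2
    simp only [Matrix.sub_apply, potPart, of_apply]
    by_cases hjn : (j : ℕ) + 1 < n
    · rw [if_pos hjn, hD i j hjn]
      split_ifs <;> first | (exfalso; omega) | simp
    · rw [if_neg hjn]
      by_cases hij : i = j
      · subst hij; simp [hD2]
      · have : (n - 1 - i) % 2 = 0 := by omega
        simp [hij, this]
  ext i j
  rw [mul_apply, Matrix.zero_apply]
  apply Finset.sum_eq_zero
  intro l _
  by_cases h : (n - 1 - l) % 2 = 0
  · rw [key l j (by omega), mul_zero]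
  · rw [key i l (by omega), zero_mul]

lemma potPart_left {F : Type*} [Field F] {n : ℕ} (hn : 3 ≤ n)
    (D : Matrix (Fin n) (Fin n) F) (d : Fin n → F)
    (h3 : d ⟨n - 1, by omega⟩ ≠ d ⟨n - 2, by omega⟩) :
    ∃ (φ : Fin n → F) (j : Fin n), φ ≠ 0 ∧ d j ≠ 0 ∧ φ ᵥ* potPart D d = d j • φ := by
  set E := potPart D d with hE
  let la : Fin n := ⟨n - 1, by omega⟩
  let m : Fin n := ⟨n - 2, by omega⟩
  have hml : m ≠ la := by intro h; simp [m, la, Fin.ext_iff] at h; omega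
  have e1 : Pi.single m 1 ᵥ* E = d m • Pi.single m 1 := by
    ext j
    have hj := j.2
    simp only [single_one_vecMul, row_apply, hE, potPart, of_apply, Pi.smul_apply,
      Pi.single_apply, smul_eq_mul, Fin.ext_iff, m]
    by_cases h : (j : ℕ) = n - 2
    · have h1 : (j : ℕ) + 1 < n := by omega
      have h2 : j = m := Fin.ext h
      have h4 : n - 2 + 1 < n := by omega
      simp [h2, m, h4]
    · have h' : ¬ (n - 2 = (j : ℕ)) := fun hh => h hh.symm
      simp only [h, h', if_false, mul_zero]
      split_ifs <;> first | rfl | (exfalso; omega)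
  have e2 : Pi.single la 1 ᵥ* E = Pi.single m 1 + d la • Pi.single la 1 := by
    ext j
    have hj := j.2
    simp only [single_one_vecMul, row_apply, hE, potPart, of_apply, Pi.smul_apply, Pi.add_apply,
      Pi.single_apply, smul_eq_mul, Fin.ext_iff, m, la]
    by_cases h : (j : ℕ) = n - 1
    · have h2 : j = la := Fin.ext h
      have h3 : ¬ (n - 1 = n - 2) := by omega
      have h4 : ¬ (n - 1 + 1 < n) := by omega
      simp [h2, la, h3, h4]
    · have h' : ¬ (n - 1 = (j : ℕ)) := fun hh => h hh.symm
      have h1 : (j : ℕ) + 1 < n := by omega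
      simp only [h, h', h1, if_false, if_true, mul_zero, add_zero]
      split_ifs <;> first | rfl | (exfalso; omega)
  by_cases hm : d m = 0
  · have hl : d la ≠ 0 := by rw [← hm]; exact h3
    refine ⟨(d la)⁻¹ • Pi.single m 1 + Pi.single la 1, la, ?_, hl, ?_⟩
    · intro h
      have := congrFun h la
      simp [hml.symm] at this
    · rw [add_vecMul, smul_vecMul, e1, e2, hm, zero_smul, smul_zero, zero_add, smul_add,
        smul_smul, mul_inv_cancel₀ hl, one_smul]
  · refine ⟨Pi.single m 1, m, ?_, hm, e1⟩
    intro h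
    have := congrFun h m
    simp at this

lemma exists_diag (p : ℕ) [Fact p.Prime] (hp : Odd p) (n : ℕ) (hn : 3 ≤ n)
    (hn3 : n = 3 → (3 : ZMod p) ≠ 0) (t : ZMod p) :
    ∃ (β : ZMod p) (δ : Fin n → ZMod p),
      (∀ j : Fin n, (j : ℕ) + 1 < n → (n - 1 - j) % 2 = 0 → δ j = β) ∧
      (∀ j : Fin n, (n - 1 - j) % 2 = 1 → δ j ≠ β) ∧
      δ ⟨n - 1, by omega⟩ ≠ β ∧ δ ⟨n - 1, by omega⟩ ≠ δ ⟨n - 2, by omega⟩ ∧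
      ∑ i, δ i = t := by
  have two : (2 : ZMod p) ≠ 0 := by
    intro h
    have h' : ((2 : ℕ) : ZMod p) = 0 := by exact_mod_cast h
    rw [ZMod.natCast_eq_zero_iff] at h'
    have := Nat.le_of_dvd (by norm_num) h'
    have h2 := (Fact.out : p.Prime).two_le
    have : p = 2 := by omega
    subst this
    exact absurd hp (by decide)
  have one : (1 : ZMod p) ≠ 0 := one_ne_zero
  let δ0 : Fin n → ZMod p := fun j =>
    if (j : ℕ) + 1 < n then (if (n - 1 - j) % 2 = 1 then 1 else 0) else -1
  have hla : ∀ j : Fin n, (j : ℕ) = n - 1 → δ0 j = -1 := by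
    intro j hj
    simp only [δ0]; rw [if_neg (by omega)]
  have hev : ∀ j : Fin n, (j : ℕ) + 1 < n → (n - 1 - j) % 2 = 0 → δ0 j = 0 := by
    intro j hj hj2
    simp only [δ0]; rw [if_pos hj, if_neg (by omega)]
  have hod : ∀ j : Fin n, (n - 1 - j) % 2 = 1 → δ0 j = 1 := by
    intro j hj2
    simp only [δ0]; rw [if_pos (by omega), if_pos hj2]
  by_cases hn0 : (n : ZMod p) = 0
  · have h5 : 5 ≤ n := by
      by_contra hlt
      have : n = 3 ∨ n = 4 := by omega
      rcases this with h | h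
      · apply hn3 h; rw [h] at hn0; exact_mod_cast hn0
      · rw [h] at hn0; push_cast at hn0
        have : (2 : ZMod p) * 2 = 0 := by rw [← hn0]; norm_num
        simp [two] at this
    set T := t - ∑ i, δ0 i with hT
    let i4 : Fin n := ⟨n - 4, by omega⟩
    by_cases hT1 : T = -1
    · by_cases h6 : 6 ≤ n
      · let i6 : Fin n := ⟨n - 6, by omega⟩
        have hne : i6 ≠ i4 := by simp [i4, i6, Fin.ext_iff]; omega
        refine ⟨0, fun i => δ0 i + ((Pi.single i4 1 : Fin n → ZMod p) i + (Pi.single i6 (-2) : Fin n → ZMod p) i),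
          ?_, ?_, ?_, ?_, ?_⟩
        · intro j hj hj2
          have a4 : j ≠ i4 := by rintro rfl; simp [i4] at hj2; omega
          have a6 : j ≠ i6 := by rintro rfl; simp [i6] at hj2; omega
          simp [hev j hj hj2, a4, a6]
        · intro j hj
          beta_reduce; rw [hod j hj]
          by_cases a4 : j = i4
          · subst a4
            simp only [Pi.single_eq_same, Pi.single_eq_of_ne hne.symm]
            intro h; apply two; linear_combination h
          · by_cases a6 : j = i6
            · subst a6
              simp only [Pi.single_eq_same, Pi.single_eq_of_ne hne]
              intro h; apply one; linear_combination -h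
            · simp [a4, a6]
        · beta_reduce; rw [hla ⟨n - 1, by omega⟩ rfl, Pi.single_eq_of_ne (by simp [i4, Fin.ext_iff]; omega),
            Pi.single_eq_of_ne (by simp [i6, Fin.ext_iff]; omega)]
          simp
        · beta_reduce; rw [hla ⟨n - 1, by omega⟩ rfl, Pi.single_eq_of_ne (by simp [i4, Fin.ext_iff]; omega),
            Pi.single_eq_of_ne (by simp [i6, Fin.ext_iff]; omega),
            hod ⟨n - 2, by omega⟩ (by simp; omega), Pi.single_eq_of_ne (by simp [i4, Fin.ext_iff]; omega),
            Pi.single_eq_of_ne (by simp [i6, Fin.ext_iff]; omega)]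
          intro h; apply two; linear_combination -h
        · simp only [Finset.sum_add_distrib, Finset.sum_pi_single', Finset.mem_univ, if_true,
            Fintype.sum_pi_single']
          linear_combination hT - hT1
      · have hn5 : n = 5 := by omega
        have five : (5 : ZMod p) = 0 := by rw [hn5] at hn0; exact_mod_cast hn0
        let la : Fin n := ⟨n - 1, by omega⟩
        have hne : la ≠ i4 := by simp [i4, la, Fin.ext_iff]; omega
        refine ⟨0, fun i => δ0 i + ((Pi.single i4 (-4) : Fin n → ZMod p) i + (Pi.single la 3 : Fin n → ZMod p) i),
          ?_, ?_, ?_, ?_, ?_⟩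
        · intro j hj hj2
          have a4 : j ≠ i4 := by rintro rfl; simp [i4] at hj2; omega
          have a6 : j ≠ la := by rintro rfl; simp [la] at hj; omega
          simp [hev j hj hj2, a4, a6]
        · intro j hj
          beta_reduce; rw [hod j hj]
          have a6 : j ≠ la := by rintro rfl; simp [la] at hj
          by_cases a4 : j = i4
          · subst a4
            simp only [Pi.single_eq_same, Pi.single_eq_of_ne hne.symm]
            intro h; apply two; linear_combination h + five
          · simp [a4, a6]
        · beta_reduce; rw [hla ⟨n - 1, by omega⟩ rfl, Pi.single_eq_of_ne (by simp [i4, Fin.ext_iff]; omega)]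
          simp only [la, Pi.single_eq_same]
          intro h; apply two; linear_combination h
        · have b1 : (⟨n - 2, by omega⟩ : Fin n) ≠ i4 := by simp [i4, Fin.ext_iff]; omega
          have b2 : (⟨n - 2, by omega⟩ : Fin n) ≠ la := by simp [la, Fin.ext_iff]; omega
          change δ0 la + ((Pi.single i4 (-4) : Fin n → ZMod p) la +
            (Pi.single la 3 : Fin n → ZMod p) la) ≠ _
          beta_reduce
          rw [hla la rfl, hod ⟨n - 2, by omega⟩ (by simp; omega), Pi.single_eq_of_ne hne,
            Pi.single_eq_of_ne b1, Pi.single_eq_of_ne b2, Pi.single_eq_same]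
          intro h; apply one; linear_combination h
        · simp only [Finset.sum_add_distrib, Finset.mem_univ, if_true,
            Fintype.sum_pi_single']
          linear_combination hT - hT1
    · refine ⟨0, fun i => δ0 i + (Pi.single i4 T : Fin n → ZMod p) i, ?_, ?_, ?_, ?_, ?_⟩
      · intro j hj hj2
        have a4 : j ≠ i4 := by rintro rfl; simp [i4] at hj2; omega
        simp [hev j hj hj2, a4]
      · intro j hj
        beta_reduce; rw [hod j hj]
        by_cases a4 : j = i4
        · subst a4
          simp only [Pi.single_eq_same]
          intro h; apply hT1; linear_combination h
        · simp [a4]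
      · beta_reduce; rw [hla ⟨n - 1, by omega⟩ rfl, Pi.single_eq_of_ne (by simp [i4, Fin.ext_iff]; omega)]
        simp
      · beta_reduce; rw [hla ⟨n - 1, by omega⟩ rfl, Pi.single_eq_of_ne (by simp [i4, Fin.ext_iff]; omega),
          hod ⟨n - 2, by omega⟩ (by simp; omega), Pi.single_eq_of_ne (by simp [i4, Fin.ext_iff]; omega)]
        intro h; apply two; linear_combination -h
      · simp only [Finset.sum_add_distrib, Finset.mem_univ, if_true,
            Fintype.sum_pi_single']
        linear_combination hT
  · refine ⟨(t - ∑ i, δ0 i) / n, fun i => δ0 i + (t - ∑ i, δ0 i) / n, ?_, ?_, ?_, ?_, ?_⟩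
    · intro j hj hj2
      simp [hev j hj hj2]
    · intro j hj
      simp [hod j hj]
    · beta_reduce; rw [hla ⟨n - 1, by omega⟩ rfl]; simp
    · beta_reduce; rw [hla ⟨n - 1, by omega⟩ rfl, hod ⟨n - 2, by omega⟩ (by simp; omega)]
      intro h; apply two; linear_combination -h
    · simp only [Finset.sum_add_distrib, Finset.sum_const, Finset.card_univ, Fintype.card_fin,
        nsmul_eq_mul]
      field_simp
      ring

theorem stmt_14 {F : Type*} [Field F] (p : ℕ) [Fact p.Prime] (hp : Odd p)
    [CharP F p] (n k t : ℕ) (hn : 3 ≤ n) (hk : 0 < k) (hodd : Odd (n - k))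
    (ht : t ≤ p - 1)
    (c : Fin n → F) (C : Matrix (Fin n) (Fin n) F) (hC : C = companionMatrix c)
    (htr : C.trace = (t : F))
    (hhalf : (((n + k + 1) / 2 : ℕ) : F) ≠ 0) :
    ∃ (a : ℕ) (D E V : Matrix (Fin n) (Fin n) F),
      1 ≤ a ∧ a ≤ p - 1 ∧
      MatSimilar C D ∧ D = E + V ∧ E ^ p = E ∧ V ^ (k + 1) = 0 ∧
      (∀ i : Fin n, V i ⟨0, by omega⟩ = 0) ∧
      (∀ j : Fin n, E ⟨n - 1, by omega⟩ j =
        if (j : ℕ) = n - 1 then (a : F) else 0) := by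
  subst hC
  let ι : ZMod p →+* F := ZMod.castHom (dvd_refl p) F
  have hinj : Function.Injective ι := ι.injective
  have hn3 : n = 3 → (3 : ZMod p) ≠ 0 := by
    intro h h3
    have hk2 : k = 2 := by
      subst h
      obtain ⟨r, hr⟩ := hodd
      omega
    apply hhalf
    have h4 : ι ((3 : ℕ) : ZMod p) = 0 := by
      push_cast; rw [h3, map_zero]
    rw [h, hk2, ← map_natCast ι]
    exact h4
  obtain ⟨β, δ, h0, h1, h2, h3, hsum⟩ := exists_diag p hp n hn hn3 (t : ZMod p)
  have hpow : ∀ x : ZMod p, ι x ^ p = ι x := by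
    intro x; rw [← map_pow, ZMod.pow_card]
  obtain ⟨D, ⟨P, hP⟩, hD, hD2⟩ := exists_hessenberg (by omega : 1 ≤ n) c (fun i => ι (δ i)) (by
    rw [htr, ← map_sum, hsum, map_natCast])
  set E := potPart D (fun i => ι (δ i)) with hE
  have hEp : E ^ p = E := potPart_pow hn p D _ (ι β) (hpow β) (fun j => hpow _)
    (fun j hj hj2 => by rw [h0 j hj hj2]) (fun j hj => hinj.ne (h1 j hj)) (hinj.ne h2)
    (hinj.ne h3)
  have hVV : (D - E) * (D - E) = 0 := nilPart_sq hn D _ hD hD2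
  obtain ⟨φ, j0, hφ, hj0, hφE⟩ := potPart_left hn D (fun i => ι (δ i)) (hinj.ne h3)
  obtain ⟨v, hv, hVv, hφv⟩ := exists_kernel_vec hn (D - E) hVV φ
  obtain ⟨R, hR0, hR1⟩ := exists_frame (⟨0, by omega⟩ : Fin n) ⟨n - 1, by omega⟩
    (by simp [Fin.ext_iff]; omega) v φ hv hφ hφv
  have hδ : δ j0 ≠ 0 := by
    intro h; apply hj0; simp [h]
  have hplt := (δ j0).val_lt
  have hcast : (((δ j0).val : ℕ) : F) = ι (δ j0) := by
    rw [← map_natCast ι, ZMod.natCast_zmod_val]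
  have hRφ : Pi.single (⟨n - 1, by omega⟩ : Fin n) 1 ᵥ* (↑R⁻¹ : Matrix (Fin n) (Fin n) F) = φ := by
    rw [← hR1, vecMul_vecMul, Units.mul_inv, vecMul_one]
  refine ⟨(δ j0).val, (↑R⁻¹ : Matrix (Fin n) (Fin n) F) * D * R,
    (↑R⁻¹ : Matrix (Fin n) (Fin n) F) * E * R, (↑R⁻¹ : Matrix (Fin n) (Fin n) F) * (D - E) * R, ?_, by omega, ?_, ?_, ?_,
    ?_, ?_, ?_⟩
  · have : (δ j0).val ≠ 0 := by rwa [Ne, ZMod.val_eq_zero]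
    omega
  · refine ⟨P * R, ?_⟩
    rw [hP]
    simp [mul_assoc]
  · rw [← add_mul, ← mul_add, add_sub_cancel]
  · rw [Units.conj_pow', hEp]
  · rw [Units.conj_pow']
    have : (D - E) ^ (k + 1) = 0 := by
      obtain ⟨r, rfl⟩ : ∃ r, k = r + 1 := ⟨k - 1, by omega⟩
      rw [pow_succ, pow_succ, mul_assoc, hVV, mul_zero]
    rw [this]; simp
  · intro i
    have : (((↑R⁻¹ : Matrix (Fin n) (Fin n) F) * (D - E) * (R : Matrix (Fin n) (Fin n) F)) *ᵥ
        Pi.single (⟨0, by omega⟩ : Fin n) 1) = 0 := by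
      rw [← mulVec_mulVec, hR0, ← mulVec_mulVec, hVv, mulVec_zero]
    have := congrFun this i
    simpa only [mulVec_single_one, col_apply, Pi.zero_apply] using this
  · intro j
    have : Pi.single (⟨n - 1, by omega⟩ : Fin n) 1 ᵥ*
        ((↑R⁻¹ : Matrix (Fin n) (Fin n) F) * E * (R : Matrix (Fin n) (Fin n) F)) =
        ι (δ j0) • Pi.single (⟨n - 1, by omega⟩ : Fin n) 1 := by
      rw [← vecMul_vecMul, ← vecMul_vecMul, hRφ, hφE, smul_vecMul, hR1]
    have := congrFun this j
    rw [single_one_vecMul, row_apply] at this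
    rw [this, hcast]
    simp [Pi.single_apply, Fin.ext_iff]
end

section
/- Let F be a field of odd characteristic p, n ≥ 3, k ∈ {1,…,n−1} with n−k odd, and C ∈ M_n(F) a companion matrix such that (n−(k+1))/2 · 1_F ≠ 0 and Tr(C) = t·1_F for some t ∈ {0,…,p−1}. Then there exist D, E, V with C similar to D = E + V, E^p = E, the last row of E zero, V^{k+1} = 0, and the first column of V zero. -/
namespace Aux15

variable {F : Type*} [Field F]

lemma exists_perm {α : Type*} [DecidableEq α] (a b c d : α) (hab : a ≠ b) (hcd : c ≠ d) :
    ∃ σ : Equiv.Perm α, σ a = c ∧ σ b = d := by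
  refine ⟨(Equiv.swap a c).trans (Equiv.swap (Equiv.swap a c b) d), ?_, ?_⟩
  · simp only [Equiv.trans_apply, Equiv.swap_apply_left]
    apply Equiv.swap_apply_of_ne_of_ne
    · intro h
      apply hab
      apply (Equiv.swap a c).injective
      rw [← h, Equiv.swap_apply_left]
    · exact hcd
  · simp

lemma nilp_of_lev {n L : ℕ} (V : Matrix (Fin n) (Fin n) F) (lev : Fin n → ℕ)
    (hlev : ∀ i, lev i ≤ L) (hV : ∀ i j, lev j ≤ lev i → V i j = 0) : V ^ (L + 1) = 0 := by
  have key : ∀ r : ℕ, ∀ i j, lev j < lev i + r → (V ^ r) i j = 0 := by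
    intro r
    induction r with
    | zero =>
      intro i j h
      rw [pow_zero, Matrix.one_apply_ne]
      rintro rfl
      omega
    | succ r ih =>
      intro i j h
      rw [pow_succ, Matrix.mul_apply]
      apply Finset.sum_eq_zero
      intro l _
      by_cases hl : lev j ≤ lev l
      · rw [hV l j hl, mul_zero]
      · rw [ih i l (by omega), zero_mul]
  ext i j
  rw [key (L + 1) i j (by have := hlev j; omega)]
  rfl

lemma pow_eig {n : ℕ} (E : Matrix (Fin n) (Fin n) F) (x : Fin n → F) (a : F)
    (h : E.mulVec x = a • x) (r : ℕ) : (E ^ r).mulVec x = a ^ r • x := by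
  induction r with
  | zero => simp
  | succ r ih =>
    rw [pow_succ, ← Matrix.mulVec_mulVec, h, Matrix.mulVec_smul, ih, smul_smul, pow_succ, mul_comm]

lemma pow_swap {n : ℕ} (E : Matrix (Fin n) (Fin n) F) (x y : Fin n → F)
    (h : E.mulVec x = y) (h' : E.mulVec y = x) (p : ℕ) (hp : Odd p) :
    (E ^ p).mulVec x = E.mulVec x := by
  obtain ⟨q, rfl⟩ := hp
  have h2 : (E ^ 2).mulVec x = (1 : F) • x := by
    rw [pow_two, ← Matrix.mulVec_mulVec, h, h', one_smul]
  rw [pow_succ', pow_mul, ← Matrix.mulVec_mulVec, pow_eig _ _ _ h2]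
  simp

lemma pow_tail {n : ℕ} (E : Matrix (Fin n) (Fin n) F) (x y : Fin n → F) (a : F)
    (h : E.mulVec x = y) (h' : E.mulVec y = a • y) (p : ℕ) (hp : Odd p) (ha : a ≠ 0)
    (hap : a ^ p = a) : (E ^ p).mulVec x = E.mulVec x := by
  obtain ⟨q, rfl⟩ := hp
  have h3 : a ^ (2 * q) = 1 := by
    rw [pow_succ] at hap
    exact mul_right_cancel₀ ha (by rw [hap, one_mul])
  rw [pow_succ, ← Matrix.mulVec_mulVec, h, pow_eig _ _ _ h', h3, one_smul]

def tau (K m : ℕ) (u v : F) (c : ℕ → F) : F :=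
  (u * v ^ 2 - v * c (K + 2 * m) - c (K + 2 * m - 1)) / (v - u)

def rr (K m : ℕ) (u v : F) (c : ℕ → F) (i : ℕ) : F :=
  if K ≤ i ∧ i < K + 2 * m ∧ (i - K) % 2 = 0 then
    (c (i + 1) - if i + 2 = K + 2 * m then u * tau K m u v c else 0) / v else 0

def gg (K m : ℕ) (u v : F) (c : ℕ → F) (i : ℕ) : F :=
  if i < K then - c i else
  if i < K + 2 * m ∧ (i - K) % 2 = 0 then
    tau K m u v c * rr K m u v c i - c i - (if 2 ≤ i then rr K m u v c (i - 2) else 0)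
  else if i = K + 2 * m then tau K m u v c else 0

def DD (K m : ℕ) (u v : F) (c : ℕ → F) (i j : ℕ) : F :=
  if j = K + 2 * m + 1 then (if i = K + 2 * m + 1 then v else gg K m u v c i) else
  if j + 1 = K + 2 * m then
    (if i = K + 2 * m then 1 else if i + 1 = K + 2 * m then u else rr K m u v c i)
  else if i = j + 1 then 1 else 0

def EE (K m : ℕ) (u v : F) (i j : ℕ) : F :=
  if j < K then 0 else
  if (j - K) % 2 = 0 then (if i = j + 1 then 1 else 0) else
  if j = K + 2 * m + 1 then (if i = j then v else 0) else
  if j + 1 = K + 2 * m then (if i = j then u else if i + 1 = j then 1 - u else 0) else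
  if i + 1 = j then 1 else 0

def BB (K m : ℕ) (u v : F) (c : ℕ → F) (i j : ℕ) : F :=
  if j = K + 2 * m then
    (if i = K + 2 * m then 1 else if i + 1 = K + 2 * m then -u else - rr K m u v c i) else
  if j = K + 2 * m + 1 then
    (if i = K + 2 * m + 1 then 1 else if i = K + 2 * m then -u else
      if 1 ≤ i then - rr K m u v c (i - 1) else 0)
  else if i = j then 1 else 0

def lev (K i : ℕ) : ℕ := if i < K then K - i else if (i - K) % 2 = 0 then 0 else K + 1

lemma rr_zero (K m : ℕ) (u v : F) (c : ℕ → F) (i : ℕ)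
    (h : ¬ (K ≤ i ∧ i < K + 2 * m ∧ (i - K) % 2 = 0)) : rr K m u v c i = 0 := by
  unfold rr; rw [if_neg h]

lemma VV_lev (K m : ℕ) (hm : 1 ≤ m) (u v : F) (c : ℕ → F) (i j : ℕ)
    (hi : i < K + 2 * m + 2) (hj : j < K + 2 * m + 2) (h : lev K j ≤ lev K i) :
    DD K m u v c i j - EE K m u v i j = 0 := by
  have hr : (i - K) % 2 ≠ 0 ∨ i < K → rr K m u v c i = 0 := by
    intro h; apply rr_zero; omega
  unfold lev at h
  unfold DD EE gg
  split_ifs at h ⊢ <;> first | omega | (simp; done) | (rw [hr (by omega)]; simp; done)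

def EM (K m : ℕ) (u v : F) : Matrix (Fin (K + 2 * m + 2)) (Fin (K + 2 * m + 2)) F :=
  Matrix.of fun i j => EE K m u v i j

def DM (K m : ℕ) (u v : F) (c : ℕ → F) :
    Matrix (Fin (K + 2 * m + 2)) (Fin (K + 2 * m + 2)) F :=
  Matrix.of fun i j => DD K m u v c i j

def BM (K m : ℕ) (u v : F) (c : ℕ → F) :
    Matrix (Fin (K + 2 * m + 2)) (Fin (K + 2 * m + 2)) F :=
  Matrix.of fun i j => BB K m u v c i j

lemma EM_pow (K m : ℕ) (hm : 1 ≤ m) (u v : F) (p : ℕ) (hp : Odd p) (hu : u = 0 ∨ u = 1)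
    (hv : v ≠ 0) (hvp : v ^ p = v) : EM K m u v ^ p = EM K m u v := by
  have hp0 : p ≠ 0 := by rintro rfl; simp at hp
  apply Matrix.ext_of_mulVec_single
  intro j
  have col : ∀ j, (EM K m u v).mulVec (Pi.single j 1) = fun i : Fin (K + 2 * m + 2) => EE K m u v i j := by
    intro j; ext i; simp [EM]
  obtain ⟨j, hj⟩ := j
  by_cases h1 : j < K
  · have h0 : (EM K m u v).mulVec (Pi.single ⟨j, hj⟩ 1) = (0 : F) • Pi.single ⟨j, hj⟩ 1 := by
      rw [col]; ext i; simp [EE, h1]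
    rw [pow_eig _ _ _ h0, h0, zero_pow hp0]
  by_cases h2 : (j - K) % 2 = 0
  · have hj' : j + 1 < K + 2 * m + 2 := by omega
    have h0 : (EM K m u v).mulVec (Pi.single ⟨j, hj⟩ 1) = Pi.single ⟨j + 1, hj'⟩ 1 := by
      rw [col]; ext i; simp [EE, h1, h2, Pi.single_apply, Fin.ext_iff]
    have hS : ∀ a : F, (∀ i : Fin (K + 2 * m + 2), EE K m u v i (j + 1) = if (i : ℕ) = j + 1 then a else 0) →
        (EM K m u v).mulVec (Pi.single ⟨j + 1, hj'⟩ 1) = a • Pi.single ⟨j + 1, hj'⟩ 1 := by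
      intro a ha
      rw [col]; ext i; simp [ha, Pi.single_apply, Fin.ext_iff]
    have hW : (∀ i : Fin (K + 2 * m + 2), EE K m u v i (j + 1) = if (i : ℕ) = j then 1 else 0) →
        (EM K m u v).mulVec (Pi.single ⟨j + 1, hj'⟩ 1) = Pi.single ⟨j, hj⟩ 1 := by
      intro ha
      rw [col]; ext i; simp [ha, Pi.single_apply, Fin.ext_iff]
    by_cases h3 : j = K + 2 * m
    · refine pow_tail _ _ _ v h0 (hS v ?_) p hp hv hvp
      intro i; unfold EE; split_ifs <;> first | omega | rfl
    by_cases h4 : j + 2 = K + 2 * m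
    · rcases hu with rfl | rfl
      · refine pow_swap _ _ _ h0 (hW ?_) p hp
        intro i; unfold EE; split_ifs <;> first | omega | simp
      · refine pow_tail _ _ _ 1 h0 (hS 1 ?_) p hp one_ne_zero (one_pow p)
        intro i; unfold EE; split_ifs <;> first | omega | simp
    · refine pow_swap _ _ _ h0 (hW ?_) p hp
      intro i; unfold EE; split_ifs <;> first | omega | simp
  · have hj' : j - 1 < K + 2 * m + 2 := by omega
    have h0 : (EM K m u v).mulVec (Pi.single ⟨j - 1, hj'⟩ 1) = Pi.single ⟨j, hj⟩ 1 := by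
      rw [col]; ext i
      have e1 : ¬ (j - 1 < K) := by omega
      have e2 : (j - 1 - K) % 2 = 0 := by omega
      have e3 : j - 1 + 1 = j := by omega
      simp [EE, e1, e2, e3, Pi.single_apply, Fin.ext_iff]
    have hS : ∀ a : F, a ^ p = a → (∀ i : Fin (K + 2 * m + 2), EE K m u v i j = if (i : ℕ) = j then a else 0) →
        (EM K m u v ^ p).mulVec (Pi.single ⟨j, hj⟩ 1) = (EM K m u v).mulVec (Pi.single ⟨j, hj⟩ 1) := by
      intro a ha' ha
      have : (EM K m u v).mulVec (Pi.single ⟨j, hj⟩ 1) = a • Pi.single ⟨j, hj⟩ 1 := by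
        rw [col]; ext i; simp [ha, Pi.single_apply, Fin.ext_iff]
      rw [pow_eig _ _ _ this, this, ha']
    have hW : (∀ i : Fin (K + 2 * m + 2), EE K m u v i j = if (i : ℕ) = j - 1 then 1 else 0) →
        (EM K m u v).mulVec (Pi.single ⟨j, hj⟩ 1) = Pi.single ⟨j - 1, hj'⟩ 1 := by
      intro ha
      rw [col]; ext i; simp [ha, Pi.single_apply, Fin.ext_iff]
    by_cases h3 : j = K + 2 * m + 1
    · refine hS v hvp ?_
      intro i; unfold EE; split_ifs <;> first | omega | rfl
    by_cases h4 : j + 1 = K + 2 * m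
    · rcases hu with rfl | rfl
      · refine pow_swap _ _ _ (hW ?_) h0 p hp
        intro i; unfold EE; split_ifs <;> first | omega | simp
      · refine hS 1 (one_pow p) ?_
        intro i; unfold EE; split_ifs <;> first | omega | simp
    · refine pow_swap _ _ _ (hW ?_) h0 p hp
      intro i; unfold EE; split_ifs <;> first | omega | simp

lemma BM_det (K m : ℕ) (u v : F) (c : ℕ → F) : (BM K m u v c).det = 1 := by
  rw [Matrix.det_of_isUpperTriangular]
  · apply Finset.prod_eq_one
    intro i _
    simp only [BM, Matrix.of_apply, BB]
    split_ifs <;> first | omega | rfl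
  · intro i j hij
    have hij : (j : ℕ) < i := hij
    have := i.2
    have hr : K + 2 * m ≤ (i : ℕ) → rr K m u v c i = 0 := by
      intro h; apply rr_zero; omega
    simp only [BM, Matrix.of_apply, BB]
    split_ifs <;> first | omega | rfl | (rw [hr (by omega), neg_zero])

lemma sum_shift (M i : ℕ) (f : ℕ → F) :
    (∑ l : Fin M, if i = (l : ℕ) + 1 then f l else 0)
      = if 1 ≤ i ∧ i ≤ M then f (i - 1) else 0 := by
  rw [Fin.sum_univ_eq_sum_range (fun l => if i = l + 1 then f l else 0) M]
  split_ifs with h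
  · rw [Finset.sum_eq_single (i - 1)]
    · rw [if_pos (by omega)]
    · intro b _ hb; rw [if_neg (by omega)]
    · intro hb; simp only [Finset.mem_range] at hb; omega
  · apply Finset.sum_eq_zero
    intro l hl; simp only [Finset.mem_range] at hl
    rw [if_neg (by omega)]

lemma sum_diag (M i : ℕ) (f : ℕ → F) :
    (∑ l : Fin M, if i = (l : ℕ) then f l else 0) = if i < M then f i else 0 := by
  rw [Fin.sum_univ_eq_sum_range (fun l => if i = l then f l else 0) M]
  simp

lemma key_last (K m : ℕ) (hm : 1 ≤ m) (u v : F) (c : ℕ → F) (hv : v ≠ 0) (huv : v - u ≠ 0)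
    (htr : -c (K + 2 * m + 1) = u + v) (i : ℕ) (hi : i < K + 2 * m + 2) :
    (if 1 ≤ i then BB K m u v c (i - 1) (K + 2 * m + 1) else 0) - c i
     = (if i < K + 2 * m then gg K m u v c i else 0)
      + BB K m u v c i (K + 2 * m) * tau K m u v c
      + BB K m u v c i (K + 2 * m + 1) * v := by
  have B1 : ∀ a, BB K m u v c a (K + 2 * m) =
    (if a = K + 2 * m then 1 else if a + 1 = K + 2 * m then -u else - rr K m u v c a) := by
    intro a; simp [BB]
  have B2 : ∀ a, BB K m u v c a (K + 2 * m + 1) =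
    (if a = K + 2 * m + 1 then 1 else if a = K + 2 * m then -u else
      if 1 ≤ a then - rr K m u v c (a - 1) else 0) := by
    intro a; simp [BB]
  have R0 := rr_zero K m u v c
  by_cases h1 : i = K + 2 * m + 1
  · subst h1
    have z := R0 (K + 2 * m + 1) (by omega)
    rw [B1, B2, B2, z]
    split_ifs <;> first | omega | skip
    simp only [Nat.add_sub_cancel] at *
    linear_combination htr
  by_cases h2 : i = K + 2 * m
  · subst h2
    rw [B1, B2, B2]
    rw [if_pos (by omega), if_neg (by omega), if_neg (by omega), if_pos (by omega),
      if_neg (by omega), if_pos rfl, if_neg (by omega), if_pos rfl]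
    have e : K + 2 * m - 1 - 1 + 1 = K + 2 * m - 1 := by omega
    unfold rr
    rw [if_pos (by omega), if_pos (by omega), e]
    have ht : tau K m u v c * (v - u) = u * v ^ 2 - v * c (K + 2 * m) - c (K + 2 * m - 1) := by
      unfold tau; field_simp
    field_simp
    linear_combination -ht
  rw [if_pos (show i < K + 2 * m by omega)]
  by_cases h3 : i < K
  · have hg : gg K m u v c i = - c i := by simp [gg, h3]
    rw [hg, B1, B2, B2, R0 i (by omega), R0 (i - 1) (by omega), R0 (i - 1 - 1) (by omega)]
    split_ifs <;> first | omega | simp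
  by_cases h4 : (i - K) % 2 = 0
  · have hg : gg K m u v c i = tau K m u v c * rr K m u v c i - c i
        - (if 2 ≤ i then rr K m u v c (i - 2) else 0) := by
      unfold gg; rw [if_neg h3, if_pos (by omega)]
    have e : i - 1 - 1 = i - 2 := by omega
    have hz : 1 ≤ i → rr K m u v c (i - 1) = 0 := by
      intro h; exact R0 _ (by omega)
    rw [hg, B1, B2, B2, e]
    split_ifs <;> first | omega | (rw [hz (by omega)]; ring) | ring
  · have hg : gg K m u v c i = 0 := by
      unfold gg; rw [if_neg h3, if_neg (by omega), if_neg (by omega)]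
    have hz : 2 ≤ i → rr K m u v c (i - 1 - 1) = 0 := by
      intro h; exact R0 _ (by omega)
    have e : i - 1 + 1 = i := by omega
    have hr : v * rr K m u v c (i - 1) = c i - if i + 1 = K + 2 * m then u * tau K m u v c else 0 := by
      unfold rr
      rw [if_pos (by omega), e]
      have e2 : (i - 1 + 2 = K + 2 * m) = (i + 1 = K + 2 * m) := by
        apply propext; omega
      simp only [e2]
      field_simp
    have hri := R0 i (by omega)
    rw [hg, B1, B2, B2, hri]
    split_ifs at hr ⊢ <;> first | omega | (rw [hz (by omega)]; linear_combination hr) | linear_combination hr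

lemma key (K m : ℕ) (hm : 1 ≤ m) (u v : F) (c : ℕ → F) (hv : v ≠ 0) (huv : v - u ≠ 0)
    (htr : -c (K + 2 * m + 1) = u + v) (i j : ℕ) (hi : i < K + 2 * m + 2)
    (hj : j < K + 2 * m + 2) :
    (if 1 ≤ i then BB K m u v c (i - 1) j else 0) - c i * BB K m u v c (K + 2 * m + 1) j
     = (if i < K + 2 * m then DD K m u v c i j else 0)
      + BB K m u v c i (K + 2 * m) * DD K m u v c (K + 2 * m) j
      + BB K m u v c i (K + 2 * m + 1) * DD K m u v c (K + 2 * m + 1) j := by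
  have R0 := rr_zero K m u v c
  by_cases h1 : j = K + 2 * m + 1
  · have h := key_last K m hm u v c hv huv htr i hi
    have d1 : DD K m u v c (K + 2 * m) j = tau K m u v c := by
      unfold DD gg; split_ifs <;> first | omega | rfl
    have d2 : DD K m u v c (K + 2 * m + 1) j = v := by
      rw [h1]; unfold DD; rw [if_pos rfl, if_pos rfl]
    have d3 : i < K + 2 * m → DD K m u v c i j = gg K m u v c i := by
      intro h; unfold DD; split_ifs <;> first | omega | rfl
    have d4 : BB K m u v c (K + 2 * m + 1) j = 1 := by
      unfold BB; split_ifs <;> first | omega | rfl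
    rw [d1, d2, d4, h1, mul_one, h]
    split_ifs with h5
    · rw [← h1, d3 h5]
    · rfl
  have z1 := R0 (K + 2 * m + 1) (by omega)
  by_cases h2 : j = K + 2 * m
  · have d1 : ∀ a, DD K m u v c a j = if a = K + 2 * m + 1 then 1 else 0 := by
      intro a; unfold DD; split_ifs <;> first | omega | rfl
    have d2 : BB K m u v c (K + 2 * m + 1) j = 0 := by
      unfold BB
      rw [z1]
      split_ifs <;> first | omega | simp
    have d3 : (if 1 ≤ i then BB K m u v c (i - 1) j else 0) = BB K m u v c i (K + 2 * m + 1) := by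
      unfold BB
      split_ifs <;> first | omega | rfl
    rw [d1, d1, d1, d2, d3, if_neg (by omega : ¬ K + 2 * m = K + 2 * m + 1), if_pos rfl]
    split_ifs <;> first | omega | simp
  have b1 : ∀ a, BB K m u v c a j = if a = j then 1 else 0 := by
    intro a; unfold BB; rw [if_neg h2, if_neg h1]
  have b2 : (if 1 ≤ i then BB K m u v c (i - 1) j else 0) = if i = j + 1 then 1 else 0 := by
    rw [b1]
    split_ifs <;> first | omega | rfl
  rw [b2, b1, if_neg (by omega : ¬ K + 2 * m + 1 = j), mul_zero, sub_zero]
  by_cases h3 : j + 1 = K + 2 * m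
  · have z2 : K + 2 * m ≤ i → rr K m u v c i = 0 := by intro h; exact R0 _ (by omega)
    have d1 : ∀ a, DD K m u v c a j =
        (if a = K + 2 * m then 1 else if a + 1 = K + 2 * m then u else rr K m u v c a) := by
      intro a; unfold DD; rw [if_neg h1, if_pos h3]
    have d2 : BB K m u v c i (K + 2 * m) =
        (if i = K + 2 * m then 1 else if i + 1 = K + 2 * m then -u else - rr K m u v c i) := by
      unfold BB; rw [if_pos rfl]
    have d3 : DD K m u v c (K + 2 * m) j = 1 := by rw [d1, if_pos rfl]
    have d4 : DD K m u v c (K + 2 * m + 1) j = 0 := by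
      rw [d1, if_neg (by omega), if_neg (by omega), z1]
    rw [d3, d4, d1, d2, mul_zero, add_zero, mul_one]
    split_ifs <;> first | omega | ring1 | (rw [z2 (by omega)]; ring1)
  · have d1 : ∀ a, DD K m u v c a j = if a = j + 1 then 1 else 0 := by
      intro a; unfold DD; rw [if_neg h1, if_neg h3]
    rw [d1, d1, d1, if_neg (by omega : ¬ K + 2 * m = j + 1),
      if_neg (by omega : ¬ K + 2 * m + 1 = j + 1), mul_zero, mul_zero, add_zero, add_zero]
    split_ifs <;> first | omega | rfl

lemma CB_eq (K m : ℕ) (hm : 1 ≤ m) (u v : F) (c : ℕ → F) (hv : v ≠ 0) (huv : v - u ≠ 0)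
    (htr : -c (K + 2 * m + 1) = u + v) :
    companionMatrix (fun i : Fin (K + 2 * m + 2) => c i) * BM K m u v c
      = BM K m u v c * DM K m u v c := by
  ext i j
  have hk := key K m hm u v c hv huv htr i j i.2 j.2
  rw [Matrix.mul_apply, Matrix.mul_apply]
  rw [Fin.sum_univ_castSucc (fun l => companionMatrix _ i l * _),
    Fin.sum_univ_castSucc (fun l => BM K m u v c i l * _),
    Fin.sum_univ_castSucc (fun l => BM K m u v c i (Fin.castSucc l) * _)]
  have s1 : ∀ l : Fin (K + 2 * m + 1),
      companionMatrix (fun i : Fin (K + 2 * m + 2) => c i) i l.castSucc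
        * BM K m u v c l.castSucc j
      = if (i : ℕ) = (l : ℕ) + 1 then BB K m u v c l j else 0 := by
    intro l
    have := l.2
    simp only [companionMatrix, BM, Matrix.of_apply, Fin.val_castSucc]
    split_ifs <;> first | omega | simp
  have s2 : ∀ l : Fin (K + 2 * m),
      BM K m u v c i l.castSucc.castSucc * DM K m u v c l.castSucc.castSucc j
      = if (i : ℕ) = (l : ℕ) then DD K m u v c l j else 0 := by
    intro l
    have := l.2
    simp only [BB, DM, BM, Matrix.of_apply, Fin.val_castSucc]
    split_ifs <;> first | omega | simp
  rw [Finset.sum_congr rfl (fun l _ => s1 l), Finset.sum_congr rfl (fun l _ => s2 l),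
    sum_shift _ _ (fun l => BB K m u v c l j), sum_diag _ _ (fun l => DD K m u v c l j)]
  have e : (1 ≤ (i : ℕ) ∧ (i : ℕ) ≤ K + 2 * m + 1) = (1 ≤ (i : ℕ)) := by
    have := i.2
    apply propext; omega
  simp only [e]
  simp only [companionMatrix, BM, DM, Matrix.of_apply, Fin.val_last, Fin.val_castSucc]
  rw [if_pos (by omega : K + 2 * m + 1 = K + 2 * m + 2 - 1)]
  rw [← hk]
  ring

lemma main (p : ℕ) (hp : Odd p) (K m : ℕ) (hm : 1 ≤ m) (u v : F) (hu : u = 0 ∨ u = 1)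
    (hv : v ≠ 0) (hvp : v ^ p = v) (huv : v - u ≠ 0)
    (c : Fin (K + 2 * m + 2) → F) (htr : (companionMatrix c).trace = u + v) :
    ∃ D E V : Matrix (Fin (K + 2 * m + 2)) (Fin (K + 2 * m + 2)) F,
      MatSimilar (companionMatrix c) D ∧ D = E + V ∧ E ^ p = E ∧ V ^ (K + 2) = 0 ∧
      (∀ i, V i ⟨0, by omega⟩ = 0) ∧
      (∀ j, E ⟨K + 2 * m + 2 - 1, by omega⟩ j = 0) := by
  let c' : ℕ → F := fun i => if h : i < K + 2 * m + 2 then c ⟨i, h⟩ else 0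
  have hc : c = fun i : Fin (K + 2 * m + 2) => c' i := by
    ext i; simp [c']
  have htr' : -c' (K + 2 * m + 1) = u + v := by
    rw [← htr, Matrix.trace, Fin.sum_univ_castSucc, Finset.sum_eq_zero]
    · simp only [Matrix.diag_apply, companionMatrix, Matrix.of_apply, Fin.val_last]
      rw [if_pos (by omega)]
      simp [c', Fin.last]
    · intro l _
      have := l.2
      simp only [Matrix.diag_apply, companionMatrix, Matrix.of_apply, Fin.val_castSucc]
      split_ifs <;> first | omega | rfl
  have hCB := CB_eq K m hm u v c' hv huv htr'
  rw [← hc] at hCB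
  obtain ⟨σ, h0, h1⟩ := exists_perm (⟨0, by omega⟩ : Fin (K + 2 * m + 2))
    ⟨K + 2 * m + 2 - 1, by omega⟩ ⟨K, by omega⟩ ⟨K + 2 * m, by omega⟩
    (by simp [Fin.ext_iff]) (by simp [Fin.ext_iff]; omega)
  have hpow : ∀ (A : Matrix (Fin (K + 2 * m + 2)) (Fin (K + 2 * m + 2)) F) (r : ℕ),
      (A.submatrix σ σ) ^ r = (A ^ r).submatrix σ σ := by
    intro A r
    induction r with
    | zero => simp
    | succ r ih => rw [pow_succ, pow_succ, ih, Matrix.submatrix_mul_equiv]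
  refine ⟨(DM K m u v c').submatrix σ σ, (EM K m u v).submatrix σ σ,
    (DM K m u v c' - EM K m u v).submatrix σ σ, ?_, ?_, ?_, ?_, ?_, ?_⟩
  · set P := (BM K m u v c').submatrix id σ with hP
    have hdet : IsUnit P.det := by
      rw [hP, Matrix.det_permute', BM_det, mul_one]
      rcases Int.units_eq_one_or (Equiv.Perm.sign σ) with h | h <;> simp [h]
    have hPu : IsUnit P := (Matrix.isUnit_iff_isUnit_det P).2 hdet
    obtain ⟨U, hU⟩ := hPu
    refine ⟨U, ?_⟩
    rw [Units.eq_mul_inv_iff_mul_eq, hU, hP, Matrix.submatrix_mul_equiv, ← hCB]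
    ext i j
    simp [Matrix.mul_apply]
  · ext i j; simp
  · rw [hpow, EM_pow K m hm u v p hp hu hv hvp]
  · rw [hpow, nilp_of_lev (L := K + 1) (DM K m u v c' - EM K m u v) (fun i => lev K i)]
    · rfl
    · intro i; unfold lev; split_ifs <;> omega
    · intro i j h
      exact VV_lev K m hm u v c' i j i.2 j.2 h
  · intro i
    rw [Matrix.submatrix_apply, h0]
    apply VV_lev K m hm u v c' _ _ (σ i).2 (by simp; omega)
    simp [lev]
  · intro j
    rw [Matrix.submatrix_apply, h1]
    simp only [EM, Matrix.of_apply]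
    have := (σ j).2
    unfold EE
    split_ifs <;> first | omega | rfl

end Aux15

theorem stmt_15 {F : Type*} [Field F] (p : ℕ) [Fact p.Prime] (hp : Odd p)
    [CharP F p] (n k t : ℕ) (hn : 3 ≤ n) (hk1 : 1 ≤ k) (hk2 : k ≤ n - 1) (hodd : Odd (n - k))
    (ht : t ≤ p - 1)
    (c : Fin n → F) (C : Matrix (Fin n) (Fin n) F) (hC : C = companionMatrix c)
    (htr : C.trace = (t : F))
    (hhalf : (((n - (k + 1)) / 2 : ℕ) : F) ≠ 0) :
    ∃ D E V : Matrix (Fin n) (Fin n) F,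
      MatSimilar C D ∧ D = E + V ∧ E ^ p = E ∧ V ^ (k + 1) = 0 ∧
      (∀ i : Fin n, V i ⟨0, by omega⟩ = 0) ∧
      (∀ j : Fin n, E ⟨n - 1, by omega⟩ j = 0) := by
  obtain ⟨m, hm⟩ := hodd
  obtain ⟨K, rfl⟩ : ∃ K, k = K + 1 := ⟨k - 1, by omega⟩
  obtain rfl : n = K + 2 * m + 2 := by omega
  have hm1 : 1 ≤ m := by
    rcases Nat.eq_zero_or_pos m with rfl | h
    · exfalso; apply hhalf
      have : (K + 2 * 0 + 2 - (K + 1 + 1)) / 2 = 0 := by omega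
      rw [this, Nat.cast_zero]
    · exact h
  subst hC
  have h2 : (2 : F) ≠ 0 := by
    intro h
    have h' : ((2 : ℕ) : F) = 0 := by exact_mod_cast h
    rw [CharP.cast_eq_zero_iff F p] at h'
    have := Nat.le_of_dvd (by norm_num) h'
    have := (Fact.out : p.Prime).two_le
    obtain ⟨q, hq⟩ := hp
    omega
  by_cases ht0 : (t : F) = 0
  · refine Aux15.main p hp K m hm1 1 (-1) (Or.inr rfl) (by simp) hp.neg_one_pow ?_ c ?_
    · intro h; apply h2; linear_combination -h
    · rw [htr, ht0]; ring
  · refine Aux15.main p hp K m hm1 0 (t : F) (Or.inl rfl) ht0 ?_ ?_ c ?_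
    · have := map_natCast (frobenius F p) t
      rwa [frobenius_def] at this
    · simpa using ht0
    · rw [htr]; ring
end
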